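/- arXiv:2302.02026 — 2 statements merged into one kernel-verified Lean document; each statement's English description precedes it below -/
import Mathlib

section
/- Every complex algebraic curve X ⊆ ℂ^n is blow-spherical homeomorphic at infinity to a plane algebraic curve, i.e., there exists a complex algebraic curve Y ⊆ ℂ² such that X and Y are blow-spherical homeomorphic at infinity. -/
open Filter Set Topology

noncomputable section

section TopDefs

variable {α β : Type*} [TopologicalSpace α] [TopologicalSpace β]

/-- `h` restricts to a homeomorphism from `X` onto `Y` (for the subspace topologies). -/
def IsHomeoOn (h : α → β) (X : Set α) (Y : Set β) : Prop :=
  Set.BijOn h X Y ∧ ContinuousOn h X ∧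
    ∃ g : β → α, (∀ x ∈ X, g (h x) = x) ∧ (∀ y ∈ Y, h (g y) = y) ∧ ContinuousOn g Y

/-- `A` is a topological manifold of dimension `d` (charts onto open subsets of `ℝ^d`). -/
def IsTopManifoldOfDim (A : Set α) (d : ℕ) : Prop :=
  ∀ a ∈ A, ∃ W : Set α, IsOpen W ∧ a ∈ W ∧
    ∃ (U : Set (EuclideanSpace ℝ (Fin d))) (f : α → EuclideanSpace ℝ (Fin d)),
      IsOpen U ∧ IsHomeoOn f (A ∩ W) U

/-- The model half-space in `ℝ^d`. -/
def halfSpace (d : ℕ) : Set (EuclideanSpace ℝ (Fin d)) :=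
  {u | ∀ hd : 0 < d, 0 ≤ u ⟨0, hd⟩}

/-- `A` is a topological manifold with boundary of dimension `d`
(charts onto relatively open subsets of the half-space of `ℝ^d`). -/
def IsTopManifoldWithBoundaryOfDim (A : Set α) (d : ℕ) : Prop :=
  ∀ a ∈ A, ∃ W : Set α, IsOpen W ∧ a ∈ W ∧
    ∃ (V : Set (EuclideanSpace ℝ (Fin d))) (f : α → EuclideanSpace ℝ (Fin d)),
      IsOpen V ∧ IsHomeoOn f (A ∩ W) (V ∩ halfSpace d)

end TopDefs

section BlowSpherical

variable {E F : Type*} [NormedAddCommGroup E] [NormedSpace ℝ E]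
  [NormedAddCommGroup F] [NormedSpace ℝ F]

/-- The inverse of the spherical blow-up at `p`, `x ↦ ((x-p)/‖x-p‖, ‖x-p‖)`. -/
def blowupInv (p x : E) : E × ℝ := (‖x - p‖⁻¹ • (x - p), ‖x - p‖)

/-- The inverse of the spherical blow-up at infinity, `x ↦ (x/‖x‖, 1/‖x‖)`. -/
def blowupInvInf (x : E) : E × ℝ := (‖x‖⁻¹ • x, ‖x‖⁻¹)

/-- The strict transform of `X` under the spherical blow-up at `p`. -/
def strictTransform (X : Set E) (p : E) : Set (E × ℝ) := closure (blowupInv p '' (X \ {p}))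

/-- The strict transform of `X` under the spherical blow-up at infinity. -/
def strictTransformInf (X : Set E) : Set (E × ℝ) := closure (blowupInvInf '' (X \ {0}))

/-- The strict transform at `p ∈ E ∪ {∞}`, where `none` stands for `∞`. -/
def strictTransformO (X : Set E) : Option E → Set (E × ℝ)
  | some p => strictTransform X p
  | none => strictTransformInf X

/-- The boundary of a strict transform: the points with second coordinate `0`. -/
def transformBoundary (T : Set (E × ℝ)) : Set (E × ℝ) := {z ∈ T | z.2 = 0}

/-- The filter of neighbourhoods of infinity within `X`. -/
def atInftyOn (X : Set E) : Filter E :=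
  Filter.comap (fun x : E => ‖x‖) Filter.atTop ⊓ Filter.principal X

/-- `q = lim_{x → p} h(x)` where `p ∈ E ∪ {∞}`, `q ∈ F ∪ {∞}` (`none` stands for `∞`). -/
def BSLimit (h : E → F) (X : Set E) : Option E → Option F → Prop
  | some p, some q => Filter.Tendsto h (nhdsWithin p X) (nhds q)
  | some p, none => Filter.Tendsto (fun x => ‖h x‖) (nhdsWithin p X) Filter.atTop
  | none, some q => Filter.Tendsto h (atInftyOn X) (nhds q)
  | none, none => Filter.Tendsto (fun x => ‖h x‖) (atInftyOn X) Filter.atTop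

/-- The inverse of the spherical blow-up at `p ∈ E ∪ {∞}`. -/
def blowupInvO : Option E → E → E × ℝ
  | some p, x => blowupInv p x
  | none, x => blowupInvInf x

/-- `x` is the center of the spherical blow-up at `p ∈ E ∪ {∞}` (at infinity, the center is `0`). -/
def IsCenter : Option E → E → Prop
  | some p, x => x = p
  | none, x => x = 0

/-- `h` is a blow-spherical homeomorphism from `X` onto `Y` at `p ∈ E ∪ {∞}` (with
`q = lim_{x → p} h(x) ∈ F ∪ {∞}`): `h` is a homeomorphism from `X` onto `Y` and the induced map
between the strict transforms extends to a homeomorphism `Φ` of the strict transforms. -/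
def IsBSHomeoAtO (h : E → F) (X : Set E) (Y : Set F) (po : Option E) (qo : Option F) : Prop :=
  IsHomeoOn h X Y ∧ BSLimit h X po qo ∧
    ∃ Φ : E × ℝ → F × ℝ,
      IsHomeoOn Φ (strictTransformO X po) (strictTransformO Y qo) ∧
      ∀ x ∈ X, ¬ IsCenter po x → ¬ IsCenter qo (h x) →
        Φ (blowupInvO po x) = blowupInvO qo (h x)

/-- `h` is a (global) blow-spherical homeomorphism from `X` onto `Y`: it is a blow-spherical
homeomorphism at every `p ∈ closure X ∪ {∞}`. -/
def IsBSHomeo (h : E → F) (X : Set E) (Y : Set F) : Prop :=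
  IsHomeoOn h X Y ∧
    (∀ p ∈ closure X, ∃ qo : Option F, IsBSHomeoAtO h X Y (some p) qo) ∧
    (∃ qo : Option F, IsBSHomeoAtO h X Y none qo)

/-- `X` and `Y` are blow-spherical homeomorphic at infinity: outside suitable compact sets there
is a homeomorphism which is blow-spherical at `∞`. -/
def BSHomeoAtInfinity (X : Set E) (Y : Set F) : Prop :=
  ∃ (K : Set E) (K' : Set F), IsCompact K ∧ IsCompact K' ∧
    ∃ h : E → F, IsBSHomeoAtO h (X \ K) (Y \ K') none none

/-- The tangent cone of `X` at `p`. -/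
def tangConeAt (X : Set E) (p : E) : Set E :=
  {v | ∃ (x : ℕ → E) (t : ℕ → ℝ), (∀ i, x i ∈ X) ∧ (∀ i, 0 < t i) ∧
    Filter.Tendsto x Filter.atTop (nhds p) ∧
    Filter.Tendsto (fun i => (t i)⁻¹ • (x i - p)) Filter.atTop (nhds v)}

/-- The tangent cone of `X` at infinity. -/
def tangConeInf (X : Set E) : Set E :=
  {v | ∃ (x : ℕ → E) (t : ℕ → ℝ), (∀ i, x i ∈ X) ∧ (∀ i, 0 < t i) ∧
    Filter.Tendsto (fun i => ‖x i‖) Filter.atTop Filter.atTop ∧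
    Filter.Tendsto (fun i => (t i)⁻¹ • x i) Filter.atTop (nhds v)}

/-- The tangent cone of `X` at `p ∈ E ∪ {∞}`. -/
def tangConeO (X : Set E) : Option E → Set E
  | some p => tangConeAt X p
  | none => tangConeInf X

/-- `Cone_∞(A) = {t • a : a ∈ A, t ≥ 1}`. -/
def coneInfSet (A : Set E) : Set E := {y | ∃ a ∈ A, ∃ t : ℝ, 1 ≤ t ∧ y = t • a}

/-- The inner distance on `X`: the infimum of lengths of paths in `X` joining `x` to `y`. -/
def innerDist (X : Set E) (x y : E) : ENNReal :=
  ⨅ (γ : ℝ → E) (_ : ContinuousOn γ (Set.Icc 0 1)) (_ : Set.MapsTo γ (Set.Icc 0 1) X)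
    (_ : γ 0 = x) (_ : γ 1 = y), eVariationOn γ (Set.Icc 0 1)

/-- `X` is Lipschitz normally embedded. -/
def IsLNE (X : Set E) : Prop :=
  ∃ c : ℝ, 1 ≤ c ∧ ∀ x ∈ X, ∀ y ∈ X, innerDist X x y ≤ ENNReal.ofReal (c * ‖x - y‖)

/-- `X` is Lipschitz normally embedded at the point `p`. -/
def IsLNEAt (X : Set E) (p : E) : Prop := ∃ U : Set E, IsOpen U ∧ p ∈ U ∧ IsLNE (X ∩ U)

/-- `X` is Lipschitz normally embedded at infinity. -/
def IsLNEAtInf (X : Set E) : Prop := ∃ K : Set E, IsCompact K ∧ IsLNE (X \ K)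

/-- `X` and `Y` are outer lipeomorphic. -/
def OuterLipeo (X : Set E) (Y : Set F) : Prop :=
  ∃ (h : E → F) (lam : ℝ), 1 ≤ lam ∧ Set.BijOn h X Y ∧
    ∀ x ∈ X, ∀ x' ∈ X, lam⁻¹ * ‖x - x'‖ ≤ ‖h x - h x'‖ ∧ ‖h x - h x'‖ ≤ lam * ‖x - x'‖

/-- `X` and `Y` are outer lipeomorphic at infinity. -/
def OuterLipeoAtInf (X : Set E) (Y : Set F) : Prop :=
  ∃ (K : Set E) (K' : Set F), IsCompact K ∧ IsCompact K' ∧ OuterLipeo (X \ K) (Y \ K')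

/-- The ends of `C` relative to `R`: the connected components of `C \ {‖x‖ ≤ R}`. -/
def endsRel (C : Set E) (R : ℝ) : Set (Set E) :=
  {A | ∃ x ∈ C \ Metric.closedBall 0 R, A = connectedComponentIn (C \ Metric.closedBall 0 R) x}

/-- `X` contains a homeomorphic copy of a nonempty open subset of `ℝ^d`. -/
def HasDimGE (X : Set E) (d : ℕ) : Prop :=
  ∃ (U : Set (EuclideanSpace ℝ (Fin d))) (f : EuclideanSpace ℝ (Fin d) → E),
    IsOpen U ∧ U.Nonempty ∧ f '' U ⊆ X ∧ IsHomeoOn f U (f '' U)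

/-- `X` has (topological) dimension `d`. -/
def HasDim (X : Set E) (d : ℕ) : Prop := HasDimGE X d ∧ ¬ HasDimGE X (d + 1)

/-- `x` is a simple point of the boundary of the strict transform `T`, relative to dimension `d`:
near `x`, the connected components of `T` minus the boundary are `d`-dimensional topological
manifolds, and together with the boundary they are topological manifolds with boundary. -/
def IsSimplePointOf (T : Set (E × ℝ)) (d : ℕ) (x : E × ℝ) : Prop :=
  x ∈ transformBoundary T ∧
    ∃ W : Set (E × ℝ), IsOpen W ∧ x ∈ W ∧
      ∀ y ∈ (T ∩ W) \ transformBoundary T,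
        IsTopManifoldOfDim (connectedComponentIn ((T ∩ W) \ transformBoundary T) y) d ∧
        IsTopManifoldWithBoundaryOfDim
          (connectedComponentIn ((T ∩ W) \ transformBoundary T) y ∪ (transformBoundary T ∩ W)) d

/-- `x` is a simple point of the boundary of the strict transform `T` of the set `X`. -/
def IsSimplePoint (X : Set E) (T : Set (E × ℝ)) (x : E × ℝ) : Prop :=
  ∃ d : ℕ, HasDim X d ∧ IsSimplePointOf T d x

/-- The relative multiplicity: for every sufficiently small open neighbourhood `W` of `x`,
the number of connected components of `(T \ ∂T) ∩ W` whose closure contains `x` equals `k`. -/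
def RelMultAt (T : Set (E × ℝ)) (x : E × ℝ) (k : ℕ) : Prop :=
  ∃ W₀ : Set (E × ℝ), IsOpen W₀ ∧ x ∈ W₀ ∧
    ∀ W : Set (E × ℝ), IsOpen W → x ∈ W → W ⊆ W₀ →
      {C : Set (E × ℝ) |
        (∃ y ∈ (T \ transformBoundary T) ∩ W,
          C = connectedComponentIn ((T \ transformBoundary T) ∩ W) y) ∧
        x ∈ closure C}.ncard = k

/-- The relative multiplicity of the end `A` (at infinity) equals `k`: the relative multiplicity
equals `k` on a dense open subset of the boundary of the strict transform at infinity of `A`. -/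
def EndMult (A : Set E) (k : ℕ) : Prop :=
  ∃ U : Set (E × ℝ), IsOpen U ∧
    transformBoundary (strictTransformInf A) ⊆
      closure (transformBoundary (strictTransformInf A) ∩ U) ∧
    ∀ x ∈ transformBoundary (strictTransformInf A) ∩ U, RelMultAt (strictTransformInf A) x k

end BlowSpherical

section Algebraic

/-- `X ⊆ ℝ^n` is semialgebraic. -/
def IsSemialgebraic {n : ℕ} (X : Set (EuclideanSpace ℝ (Fin n))) : Prop :=
  ∃ (m : ℕ) (P : Fin m → MvPolynomial (Fin n) ℝ) (k : Fin m → ℕ)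
    (Q : (i : Fin m) → Fin (k i) → MvPolynomial (Fin n) ℝ),
    X = ⋃ i, {x | MvPolynomial.eval (fun j => x j) (P i) = 0 ∧
      ∀ l, 0 < MvPolynomial.eval (fun j => x j) (Q i l)}

/-- The map `h` is semialgebraic on `X`: its graph over `X` is a semialgebraic set. -/
def IsSemialgebraicMapOn {n m : ℕ} (h : EuclideanSpace ℝ (Fin n) → EuclideanSpace ℝ (Fin m))
    (X : Set (EuclideanSpace ℝ (Fin n))) : Prop :=
  IsSemialgebraic { z : EuclideanSpace ℝ (Fin (n + m)) |
    ∃ x ∈ X, (∀ i : Fin n, z (Fin.castAdd m i) = x i) ∧ ∀ j : Fin m, z (Fin.natAdd n j) = h x j }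

/-- `γ` is a continuous semialgebraic arc on `(ε, ∞)`. -/
def IsSemialgebraicArc {n : ℕ} (γ : ℝ → EuclideanSpace ℝ (Fin n)) (ε : ℝ) : Prop :=
  ContinuousOn γ (Set.Ioi ε) ∧
  IsSemialgebraic { z : EuclideanSpace ℝ (Fin (1 + n)) |
    ∃ t ∈ Set.Ioi ε, z (Fin.castAdd n 0) = t ∧ ∀ j : Fin n, z (Fin.natAdd 1 j) = γ t j }

/-- `X ⊆ ℂ^n` is a complex algebraic set. -/
def IsComplexAlgebraic {n : ℕ} (X : Set (EuclideanSpace ℂ (Fin n))) : Prop :=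
  ∃ (m : ℕ) (P : Fin m → MvPolynomial (Fin n) ℂ),
    X = {x | ∀ i, MvPolynomial.eval (fun j => x j) (P i) = 0}

/-- `X` is an irreducible complex algebraic set. -/
def IsIrreducibleAlg {n : ℕ} (X : Set (EuclideanSpace ℂ (Fin n))) : Prop :=
  X.Nonempty ∧ IsComplexAlgebraic X ∧
    ∀ A B : Set (EuclideanSpace ℂ (Fin n)),
      IsComplexAlgebraic A → IsComplexAlgebraic B → X = A ∪ B → X = A ∨ X = B

/-- `C` is an irreducible component of `X`: a maximal irreducible algebraic subset of `X`. -/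
def IsIrredComponent {n : ℕ} (C X : Set (EuclideanSpace ℂ (Fin n))) : Prop :=
  IsIrreducibleAlg C ∧ C ⊆ X ∧
    ∀ C' : Set (EuclideanSpace ℂ (Fin n)), IsIrreducibleAlg C' → C' ⊆ X → C ⊆ C' → C = C'

/-- The (Krull) dimension of the algebraic set `C` equals `d`: there is a strictly increasing
chain of `d+1` irreducible algebraic sets ending in `C`, and no such chain of `d+2` sets. -/
def HasAlgDim {n : ℕ} (C : Set (EuclideanSpace ℂ (Fin n))) (d : ℕ) : Prop :=
  (∃ f : Fin (d + 1) → Set (EuclideanSpace ℂ (Fin n)),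
    (∀ i, IsIrreducibleAlg (f i)) ∧ StrictMono f ∧ f (Fin.last d) = C) ∧
  ¬ ∃ f : Fin (d + 2) → Set (EuclideanSpace ℂ (Fin n)),
    (∀ i, IsIrreducibleAlg (f i)) ∧ StrictMono f ∧ f (Fin.last (d + 1)) = C

/-- `X ⊆ ℂ^n` is a complex algebraic curve: a nonempty complex algebraic set all of whose
irreducible components have complex dimension 1. -/
def IsComplexAlgebraicCurve {n : ℕ} (X : Set (EuclideanSpace ℂ (Fin n))) : Prop :=
  IsComplexAlgebraic X ∧ X.Nonempty ∧ ∀ C, IsIrredComponent C X → HasAlgDim C 1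

/-- `X ⊆ ℂ^n` is a pure dimensional complex algebraic set. -/
def IsPureDimComplexAlgebraic {n : ℕ} (X : Set (EuclideanSpace ℂ (Fin n))) : Prop :=
  IsComplexAlgebraic X ∧ X.Nonempty ∧ ∃ d, ∀ C, IsIrredComponent C X → HasAlgDim C d

/-- `S` is a 1-dimensional complex submanifold: locally the image of a holomorphic embedding,
with nowhere-vanishing derivative, of an open subset of `ℂ`. -/
def IsOneDimComplexSubmanifold {n : ℕ} (S : Set (EuclideanSpace ℂ (Fin n))) : Prop :=
  ∀ z ∈ S, ∃ (W : Set (EuclideanSpace ℂ (Fin n))) (V : Set ℂ)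
    (f : ℂ → EuclideanSpace ℂ (Fin n)),
    IsOpen W ∧ z ∈ W ∧ IsOpen V ∧ DifferentiableOn ℂ f V ∧ Set.InjOn f V ∧
    (∀ t ∈ V, derivWithin f V t ≠ 0) ∧ f '' V = S ∩ W

/-- The set of singular points of `X ⊆ ℂ^n`. -/
def SingSet {n : ℕ} (X : Set (EuclideanSpace ℂ (Fin n))) : Set (EuclideanSpace ℂ (Fin n)) :=
  {p ∈ X | ¬ ∃ U : Set (EuclideanSpace ℂ (Fin n)), IsOpen U ∧ p ∈ U ∧
    IsOneDimComplexSubmanifold (X ∩ U)}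

/-- The embedding `ι : ℂ^n → ℙ^n(ℂ)`, `x ↦ [1 : x]`. -/
def projIota {n : ℕ} (x : EuclideanSpace ℂ (Fin n)) : Projectivization ℂ (Fin (n + 1) → ℂ) :=
  Projectivization.mk ℂ (Fin.cons 1 (fun j => x j)) (by
    intro hzero
    have h0 := congrFun hzero 0
    simp at h0)

end Algebraic

section Topological

variable {E F : Type*} [NormedAddCommGroup E] [NormedSpace ℝ E]
  [NormedAddCommGroup F] [NormedSpace ℝ F]

/-- A continuous injection on a compact set is a homeomorphism onto its image. -/
theorem isHomeoOn_image_of_isCompact {α β : Type*} [TopologicalSpace α] [TopologicalSpace β]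
    [T2Space β] [Nonempty α] {f : α → β} {T : Set α} (hT : IsCompact T) (hf : ContinuousOn f T)
    (hinj : InjOn f T) : IsHomeoOn f T (f '' T) := by
  have hleft : ∀ x ∈ T, Function.invFunOn f T (f x) = x := fun x hx =>
    hinj.leftInvOn_invFunOn hx
  refine ⟨hinj.bijOn_image, hf, Function.invFunOn f T, hleft, ?_, ?_⟩
  · rintro _ ⟨x, hx, rfl⟩
    rw [hleft x hx]
  · rw [continuousOn_iff_isClosed]
    intro C hC
    refine ⟨f '' (C ∩ T), ?_, ?_⟩
    · exact ((hT.inter_left hC).image_of_continuousOn (hf.mono inter_subset_right)).isClosed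
    · ext y
      constructor
      · rintro ⟨hy, x, hx, rfl⟩
        rw [mem_preimage, hleft x hx] at hy
        exact ⟨⟨x, ⟨hy, hx⟩, rfl⟩, x, hx, rfl⟩
      · rintro ⟨⟨x, ⟨hxC, hx⟩, rfl⟩, -⟩
        refine ⟨?_, x, hx, rfl⟩
        rwa [mem_preimage, hleft x hx]

theorem inv_smul_blowupInvInf {x : E} (hx : x ≠ 0) :
    (blowupInvInf x).2⁻¹ • (blowupInvInf x).1 = x := by
  have : ‖x‖ ≠ 0 := norm_ne_zero_iff.2 hx
  simp [blowupInvInf, smul_smul, this]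

/-- The points at height `0` of the strict transform at infinity are tangent directions. -/
theorem mem_tangConeInf_of_mem_strictTransformInf {X : Set E} {z : E × ℝ}
    (hz : z ∈ strictTransformInf X) (h0 : z.2 = 0) : z.1 ∈ tangConeInf X := by
  obtain ⟨s, hs, hlim⟩ := mem_closure_iff_seq_limit.1 hz
  choose x hx hxs using hs
  have hpos : ∀ i, 0 < ‖x i‖ := fun i => norm_pos_iff.2 (hx i).2
  refine ⟨x, fun i => ‖x i‖, fun i => (hx i).1, hpos, ?_, ?_⟩
  · have h2 : Tendsto (fun i => (s i).2) atTop (𝓝 0) := by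
      have := (continuous_snd.tendsto z).comp hlim
      rwa [h0] at this
    have h3 : Tendsto (fun i => (s i).2) atTop (𝓝[>] 0) := by
      refine tendsto_nhdsWithin_iff.2 ⟨h2, Eventually.of_forall fun i => ?_⟩
      rw [← hxs i]
      exact inv_pos.2 (hpos i)
    refine h3.inv_tendsto_nhdsGT_zero.congr fun i => ?_
    simp [← hxs i, blowupInvInf]
  · refine ((continuous_fst.tendsto z).comp hlim).congr fun i => ?_
    simp [← hxs i, blowupInvInf]

theorem tangConeInf_mono {X Y : Set E} (h : X ⊆ Y) : tangConeInf X ⊆ tangConeInf Y := by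
  rintro v ⟨x, t, hx, ht⟩
  exact ⟨x, t, fun i => h (hx i), ht⟩

/-- The map induced by `p` between the spherical blow-ups at infinity. -/
def blowupMap (p : E →L[ℝ] F) (z : E × ℝ) : F × ℝ := (‖p z.1‖⁻¹ • p z.1, ‖p z.1‖⁻¹ * z.2)

theorem blowupMap_blowupInvInf (p : E →L[ℝ] F) {x : E} (hx : x ≠ 0) :
    blowupMap p (blowupInvInf x) = blowupInvInf (p x) := by
  have h : ‖x‖ ≠ 0 := norm_ne_zero_iff.2 hx
  simp only [blowupMap, blowupInvInf, map_smul, norm_smul, norm_inv, norm_norm, mul_inv, inv_inv,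
    smul_smul, Prod.mk.injEq]
  constructor
  · congr 1
    field_simp
  · field_simp

/-- A linear map which is proper on `X`, injective on `X` near infinity and injective on the
tangent directions of `X` at infinity is a blow-spherical homeomorphism at infinity. -/
theorem bsHomeoAtInfinity_image [ProperSpace E] [ProperSpace F] (p : E →L[ℝ] F)
    {X : Set E} (hX : IsClosed X)
    {c R : ℝ} (hR : 0 < R) (hc : ∀ x ∈ X, ‖x‖ ≤ c * (1 + ‖p x‖))
    (hinj : InjOn p (X ∩ {x | R ≤ ‖p x‖}))
    (htan : ∀ u ∈ tangConeInf X, ∀ v ∈ tangConeInf X, ‖u‖ = 1 → ‖v‖ = 1 →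
      ‖p u‖⁻¹ • p u = ‖p v‖⁻¹ • p v → u = v) :
    BSHomeoAtInfinity X (p '' X) := by
  set K : Set E := X ∩ {x | ‖p x‖ ≤ R} with hK
  have hKc : IsCompact K := by
    refine Metric.isCompact_of_isClosed_isBounded
      (hX.inter (isClosed_le (by fun_prop) continuous_const)) ?_
    refine (Metric.isBounded_closedBall (x := (0 : E)) (r := |c| * (1 + R))).subset ?_
    rintro x ⟨hx, hxR⟩
    rw [mem_closedBall_zero_iff]
    calc ‖x‖ ≤ c * (1 + ‖p x‖) := hc x hx
      _ ≤ |c| * (1 + ‖p x‖) := by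
        have := le_abs_self c
        have := norm_nonneg (p x)
        gcongr
      _ ≤ |c| * (1 + R) := by
        have : ‖p x‖ ≤ R := hxR
        gcongr
  have hmem : ∀ x, x ∈ X \ K ↔ x ∈ X ∧ R < ‖p x‖ := by
    intro x
    simp only [hK, Set.mem_sdiff, mem_inter_iff, mem_ofPred_eq, not_and, not_le]
    exact ⟨fun h => ⟨h.1, h.2 h.1⟩, fun h => ⟨h.1, fun _ => h.2⟩⟩
  have hne : ∀ x ∈ X \ K, x ≠ 0 := by
    rintro x hx rfl
    have := ((hmem 0).1 hx).2
    simp at this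
    linarith
  have himage : p '' X \ Metric.closedBall 0 R = p '' (X \ K) := by
    ext y
    constructor
    · rintro ⟨⟨x, hx, rfl⟩, hy⟩
      refine ⟨x, (hmem x).2 ⟨hx, ?_⟩, rfl⟩
      simpa using hy
    · rintro ⟨x, hx, rfl⟩
      refine ⟨⟨x, hx.1, rfl⟩, ?_⟩
      simpa using ((hmem x).1 hx).2
  have hdiff0 : (X \ K) \ {0} = X \ K :=
    sdiff_eq_left.2 (Set.disjoint_singleton_right.2 fun h => hne 0 h rfl)
  have hYne : ∀ y ∈ p '' (X \ K), y ≠ 0 := by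
    rintro _ ⟨x, hx, rfl⟩ h
    have := ((hmem x).1 hx).2
    rw [h, norm_zero] at this
    linarith
  have hdiff0' : (p '' (X \ K)) \ {0} = p '' (X \ K) :=
    sdiff_eq_left.2 (Set.disjoint_singleton_right.2 fun h => hYne 0 h rfl)
  set T := strictTransformInf (X \ K) with hTdef
  have hTeq : T = closure (blowupInvInf '' (X \ K)) := by rw [hTdef, strictTransformInf, hdiff0]
  -- closed conditions on the strict transform
  have hTsub : T ⊆ {z | ‖z.1‖ = 1 ∧ 0 ≤ z.2 ∧ 1 ≤ c * (z.2 + ‖p z.1‖) ∧ R * z.2 ≤ ‖p z.1‖} := by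
    rw [hTeq]
    refine closure_minimal ?_ ?_
    · rintro _ ⟨x, hx, rfl⟩
      have hx0 := hne x hx
      have hn : 0 < ‖x‖ := norm_pos_iff.2 hx0
      have hxX := (hmem x).1 hx
      refine ⟨?_, inv_nonneg.2 hn.le, ?_, ?_⟩
      · simp [blowupInvInf, norm_smul, hn.ne']
      · have := hc x hxX.1
        simp only [blowupInvInf, map_smul, norm_smul, norm_inv, norm_norm]
        rw [show c * (‖x‖⁻¹ + ‖x‖⁻¹ * ‖p x‖) = (c * (1 + ‖p x‖)) / ‖x‖ by field_simp]
        rwa [one_le_div hn]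
      · simp only [blowupInvInf, map_smul, norm_smul, norm_inv, norm_norm]
        rw [mul_comm]
        gcongr
        exact hxX.2.le
    · simp only [Set.ofPred_and]
      refine IsClosed.inter (isClosed_eq (by fun_prop) continuous_const)
        (IsClosed.inter (isClosed_le continuous_const (by fun_prop))
        (IsClosed.inter (isClosed_le continuous_const (by fun_prop))
        (isClosed_le (by fun_prop) (by fun_prop))))
  have hTclosed : IsClosed T := isClosed_closure
  have hTcompact : IsCompact T := by
    refine Metric.isCompact_of_isClosed_isBounded hTclosed ?_
    refine ((Metric.isBounded_closedBall (x := (0 : E)) (r := 1)).prod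
      (Metric.isBounded_Icc (0 : ℝ) (‖p‖ / R))).subset ?_
    intro z hz
    obtain ⟨h1, h2, -, h4⟩ := hTsub hz
    refine ⟨by simp [h1], h2, ?_⟩
    rw [le_div_iff₀ hR, mul_comm]
    refine h4.trans ?_
    simpa [h1] using p.le_opNorm z.1
  have hpne : ∀ z ∈ T, p z.1 ≠ 0 := by
    intro z hz h
    obtain ⟨h1, h2, h3, h4⟩ := hTsub hz
    rw [h, norm_zero] at h3 h4
    have : z.2 = 0 := le_antisymm (by nlinarith) h2
    rw [this] at h3
    norm_num at h3
  have hTX : ∀ z ∈ T, 0 < z.2 → z.2⁻¹ • z.1 ∈ X ∩ {x | R ≤ ‖p x‖} := by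
    intro z hz hpos
    constructor
    · rw [hTeq] at hz
      obtain ⟨s, hs, hlim⟩ := mem_closure_iff_seq_limit.1 hz
      have hl : Tendsto (fun i => (s i).2⁻¹ • (s i).1) atTop (𝓝 (z.2⁻¹ • z.1)) :=
        (((continuous_snd.tendsto z).comp hlim).inv₀ hpos.ne').smul
          ((continuous_fst.tendsto z).comp hlim)
      refine hX.mem_of_tendsto hl (Eventually.of_forall fun i => ?_)
      obtain ⟨x, hx, hxs⟩ := hs i
      rw [← hxs, inv_smul_blowupInvInf (hne x hx)]
      exact hx.1
    · obtain ⟨h1, h2, h3, h4⟩ := hTsub hz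
      simp only [mem_ofPred_eq, map_smul, norm_smul, norm_inv, Real.norm_eq_abs, abs_of_pos hpos]
      rw [inv_mul_eq_div, le_div_iff₀ hpos]
      exact h4
  have hcont : ContinuousOn (blowupMap p) T := by
    have h1 : ContinuousOn (fun z : E × ℝ => ‖p z.1‖⁻¹) T :=
      ContinuousOn.inv₀ (by fun_prop) fun z hz => norm_ne_zero_iff.2 (hpne z hz)
    exact (h1.smul (by fun_prop)).prodMk (h1.mul (by fun_prop))
  have hΦinj : InjOn (blowupMap p) T := by
    intro z hz w hw h
    obtain ⟨h1, h2, h3, h4⟩ := hTsub hz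
    obtain ⟨h1', h2', h3', h4'⟩ := hTsub hw
    have hzp : 0 < ‖p z.1‖⁻¹ := inv_pos.2 (norm_pos_iff.2 (hpne z hz))
    have hwp : 0 < ‖p w.1‖⁻¹ := inv_pos.2 (norm_pos_iff.2 (hpne w hw))
    simp only [blowupMap, Prod.mk.injEq] at h
    obtain ⟨ha, hb⟩ := h
    rcases h2.eq_or_lt with hz0 | hz0
    · have hw0 : w.2 = 0 := by
        rw [← hz0, mul_zero] at hb
        exact (mul_eq_zero.1 hb.symm).resolve_left hwp.ne'
      refine Prod.ext ?_ (hz0.symm.trans hw0.symm)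
      exact htan _ (tangConeInf_mono sdiff_subset
          (mem_tangConeInf_of_mem_strictTransformInf hz hz0.symm)) _
        (tangConeInf_mono sdiff_subset (mem_tangConeInf_of_mem_strictTransformInf hw hw0)) h1 h1' ha
    · have hw0 : 0 < w.2 := by
        rcases h2'.eq_or_lt with hw0 | hw0
        · rw [← hw0, mul_zero] at hb
          exact absurd hb (mul_pos hzp hz0).ne'
        · exact hw0
      have key : z.2⁻¹ • z.1 = w.2⁻¹ • w.1 := by
        refine hinj (hTX z hz hz0) (hTX w hw hw0) ?_
        have e1 : p (z.2⁻¹ • z.1) = (‖p z.1‖⁻¹ * z.2)⁻¹ • (‖p z.1‖⁻¹ • p z.1) := by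
          rw [map_smul, smul_smul]
          congr 1
          have := norm_ne_zero_iff.2 (hpne z hz)
          field_simp
        have e2 : p (w.2⁻¹ • w.1) = (‖p w.1‖⁻¹ * w.2)⁻¹ • (‖p w.1‖⁻¹ • p w.1) := by
          rw [map_smul, smul_smul]
          congr 1
          have := norm_ne_zero_iff.2 (hpne w hw)
          field_simp
        rw [e1, e2, ha, hb]
      have hn := congrArg norm key
      simp only [norm_smul, h1, h1', mul_one, norm_inv, Real.norm_eq_abs, abs_of_pos hz0,
        abs_of_pos hw0, inv_inj] at hn
      refine Prod.ext ?_ hn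
      rw [hn] at key
      exact smul_right_injective E (inv_ne_zero hw0.ne') key
  have hΦimage : blowupMap p '' T = strictTransformInf (p '' (X \ K)) := by
    have hS : blowupMap p '' (blowupInvInf '' (X \ K)) = blowupInvInf '' (p '' (X \ K)) := by
      rw [image_image, image_image]
      exact image_congr fun x hx => blowupMap_blowupInvInf p (hne x hx)
    rw [strictTransformInf, hdiff0', ← hS]
    apply Subset.antisymm
    · rw [hTeq] at hcont ⊢
      exact hcont.image_closure
    · refine closure_minimal (image_mono (hTeq ▸ subset_closure)) ?_
      exact (hTcompact.image_of_continuousOn hcont).isClosed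
  have hΦ : IsHomeoOn (blowupMap p) T (strictTransformInf (p '' (X \ K))) :=
    hΦimage ▸ isHomeoOn_image_of_isCompact hTcompact hcont hΦinj
  refine ⟨K, Metric.closedBall 0 R, hKc, isCompact_closedBall 0 R, p, ?_⟩
  rw [himage]
  refine ⟨?_, ?_, blowupMap p, hΦ, fun x hx _ _ => blowupMap_blowupInvInf p (hne x hx)⟩
  · obtain ⟨-, -, g, hg, -, hgc⟩ := hΦ
    have hleft : ∀ x ∈ X \ K, (g (blowupInvInf (p x))).2⁻¹ • (g (blowupInvInf (p x))).1 = x := by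
      intro x hx
      rw [← blowupMap_blowupInvInf p (hne x hx), hg, inv_smul_blowupInvInf (hne x hx)]
      rw [hTeq]
      exact subset_closure ⟨x, hx, rfl⟩
    have hbl : ∀ x ∈ X \ K, g (blowupInvInf (p x)) = blowupInvInf x := by
      intro x hx
      rw [← blowupMap_blowupInvInf p (hne x hx), hg]
      rw [hTeq]
      exact subset_closure ⟨x, hx, rfl⟩
    refine ⟨InjOn.bijOn_image ?_, p.continuous.continuousOn,
      fun y => (g (blowupInvInf y)).2⁻¹ • (g (blowupInvInf y)).1, hleft, ?_, ?_⟩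
    · intro x hx x' hx' h
      exact hinj ⟨hx.1, ((hmem x).1 hx).2.le⟩ ⟨hx'.1, ((hmem x').1 hx').2.le⟩ h
    · rintro _ ⟨x, hx, rfl⟩
      exact congrArg p (hleft x hx)
    · have hb : ContinuousOn (blowupInvInf : F → F × ℝ) (p '' (X \ K)) := by
        have h1 : ContinuousOn (fun y : F => ‖y‖⁻¹) (p '' (X \ K)) :=
          ContinuousOn.inv₀ (by fun_prop) fun y hy => norm_ne_zero_iff.2 (hYne y hy)
        exact (h1.smul continuousOn_id).prodMk h1
      have hgb : ContinuousOn (fun y => g (blowupInvInf y)) (p '' (X \ K)) := by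
        refine hgc.comp hb fun y hy => ?_
        rw [strictTransformInf, hdiff0']
        exact subset_closure ⟨y, hy, rfl⟩
      refine ContinuousOn.smul (ContinuousOn.inv₀ hgb.snd ?_) hgb.fst
      rintro _ ⟨x, hx, rfl⟩
      rw [hbl x hx]
      exact inv_ne_zero (norm_ne_zero_iff.2 (hne x hx))
  · change Tendsto (fun x => ‖p x‖) (atInftyOn (X \ K)) atTop
    rw [tendsto_atTop]
    intro b
    have h1 : ∀ᶠ x in atInftyOn (X \ K), |c| * (1 + |b|) + 1 ≤ ‖x‖ :=
      ((tendsto_comap (f := fun x : E => ‖x‖)).mono_left inf_le_left).eventually_ge_atTop _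
    have h2 : ∀ᶠ x in atInftyOn (X \ K), x ∈ X \ K :=
      (mem_principal_self _ : _ ∈ 𝓟 (X \ K)) |> fun h => mem_inf_of_right h
    filter_upwards [h1, h2] with x hx1 hx2
    by_contra! hlt
    have h3 := hc x hx2.1
    have h4 : c * (1 + ‖p x‖) ≤ |c| * (1 + |b|) := by
      have := le_abs_self c
      have := le_abs_self b
      have := norm_nonneg (p x)
      calc c * (1 + ‖p x‖) ≤ |c| * (1 + ‖p x‖) := by gcongr
        _ ≤ |c| * (1 + |b|) := by gcongr; linarith
    linarith

end Topological

section AlgebraicSets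

variable {n : ℕ}

theorem IsComplexAlgebraic.inter_zeros {X : Set (EuclideanSpace ℂ (Fin n))}
    (hX : IsComplexAlgebraic X) (g : MvPolynomial (Fin n) ℂ) :
    IsComplexAlgebraic (X ∩ {x | MvPolynomial.eval (fun j => x j) g = 0}) := by
  obtain ⟨m, P, rfl⟩ := hX
  refine ⟨m + 1, Fin.cons g P, ?_⟩
  ext x
  simp [Fin.forall_fin_succ, and_comm]

/-- An irreducible algebraic set on which a product vanishes is contained in the zeros of one of
the factors. -/
theorem IsIrreducibleAlg.eval_eq_zero_or {C : Set (EuclideanSpace ℂ (Fin n))}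
    (hC : IsIrreducibleAlg C) {f g : MvPolynomial (Fin n) ℂ}
    (h : ∀ x ∈ C, MvPolynomial.eval (fun j => x j) f * MvPolynomial.eval (fun j => x j) g = 0) :
    (∀ x ∈ C, MvPolynomial.eval (fun j => x j) f = 0) ∨
      ∀ x ∈ C, MvPolynomial.eval (fun j => x j) g = 0 := by
  rcases hC.2.2 _ _ (hC.2.1.inter_zeros f) (hC.2.1.inter_zeros g) (by
    ext x
    constructor
    · intro hx
      rcases mul_eq_zero.1 (h x hx) with h | h
      · exact Or.inl ⟨hx, h⟩
      · exact Or.inr ⟨hx, h⟩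
    · rintro (hx | hx) <;> exact hx.1) with h | h
  · exact Or.inl fun x hx => (h ▸ hx : x ∈ C ∩ _).2
  · exact Or.inr fun x hx => (h ▸ hx : x ∈ C ∩ _).2

theorem isComplexAlgebraic_singleton (p : EuclideanSpace ℂ (Fin n)) :
    IsComplexAlgebraic ({p} : Set (EuclideanSpace ℂ (Fin n))) := by
  refine ⟨n, fun i => MvPolynomial.X i - MvPolynomial.C (p i), ?_⟩
  ext x
  simp only [mem_singleton_iff, map_sub, MvPolynomial.eval_X, MvPolynomial.eval_C, sub_eq_zero,
    mem_ofPred_eq]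
  exact ⟨fun h i => h ▸ rfl, fun h => PiLp.ext h⟩

theorem isIrreducibleAlg_singleton (p : EuclideanSpace ℂ (Fin n)) :
    IsIrreducibleAlg ({p} : Set (EuclideanSpace ℂ (Fin n))) := by
  refine ⟨singleton_nonempty p, isComplexAlgebraic_singleton p, fun A B _ _ h => ?_⟩
  have hA : A ⊆ {p} := h ▸ subset_union_left
  have hB : B ⊆ {p} := h ▸ subset_union_right
  have hp : p ∈ A ∪ B := h ▸ mem_singleton p
  rcases hp with hp | hp
  · exact Or.inl (Subset.antisymm (singleton_subset_iff.2 hp) hA)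
  · exact Or.inr (Subset.antisymm (singleton_subset_iff.2 hp) hB)

theorem IsComplexAlgebraic.union {A B : Set (EuclideanSpace ℂ (Fin n))}
    (hA : IsComplexAlgebraic A) (hB : IsComplexAlgebraic B) : IsComplexAlgebraic (A ∪ B) := by
  obtain ⟨m, P, rfl⟩ := hA
  obtain ⟨k, Q, rfl⟩ := hB
  refine ⟨m * k, fun i => P (finProdFinEquiv.symm i).1 * Q (finProdFinEquiv.symm i).2, ?_⟩
  ext x
  simp only [mem_union, mem_ofPred_eq, map_mul, mul_eq_zero]
  constructor
  · rintro (h | h) i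
    · exact Or.inl (h _)
    · exact Or.inr (h _)
  · intro h
    by_contra! hne
    obtain ⟨⟨i, hi⟩, j, hj⟩ := hne
    have := h (finProdFinEquiv (i, j))
    simp [hi, hj] at this

theorem isComplexAlgebraic_of_finite {A : Set (EuclideanSpace ℂ (Fin n))} (hA : A.Finite) :
    IsComplexAlgebraic A := by
  induction A, hA using Set.Finite.induction_on with
  | empty => exact ⟨1, fun _ => 1, by ext; simp⟩
  | insert _ _ ih => exact (isComplexAlgebraic_singleton _).union ih

/-- A finite irreducible algebraic set is a point. -/
theorem IsIrreducibleAlg.subsingleton_of_finite {C : Set (EuclideanSpace ℂ (Fin n))}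
    (hC : IsIrreducibleAlg C) (hfin : C.Finite) : C.Subsingleton := by
  intro x hx y hy
  rcases hC.2.2 {x} (C \ {x}) (isComplexAlgebraic_singleton x)
    (isComplexAlgebraic_of_finite (hfin.subset sdiff_subset))
    (by simp [insert_eq_of_mem hx]) with h | h
  · rw [h] at hy
    exact hy.symm
  · rw [h] at hx
    exact absurd rfl hx.2

/-- An irreducible algebraic set of dimension one is infinite. -/
theorem HasAlgDim.infinite {C : Set (EuclideanSpace ℂ (Fin n))} (hdim : HasAlgDim C 1) :
    C.Infinite := by
  intro hfin
  obtain ⟨⟨f, hf, hmono, hlast⟩, -⟩ := hdim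
  have hlt : f 0 < C := hlast ▸ hmono (by decide)
  have hC : IsIrreducibleAlg C := hlast ▸ hf _
  obtain ⟨x, hx⟩ := (hf 0).1
  refine hlt.2 fun y hy => ?_
  rwa [hC.subsingleton_of_finite hfin hy (hlt.1 hx)]

end AlgebraicSets

section PlaneCurves

open scoped Polynomial Polynomial.Bivariate

/-- Bézout's identity for bivariate polynomials, with denominators cleared. -/
theorem exists_mul_add_mul_eq_C {p q : ℂ[X][Y]}
    (h : IsCoprime (p.map (algebraMap ℂ[X] (FractionRing ℂ[X])))
      (q.map (algebraMap ℂ[X] (FractionRing ℂ[X])))) :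
    ∃ (u v : ℂ[X][Y]) (c : ℂ[X]), c ≠ 0 ∧ u * p + v * q = Polynomial.C c := by
  obtain ⟨u, v, huv⟩ := h
  obtain ⟨b, hb, hb'⟩ := IsLocalization.integerNormalization_spec (nonZeroDivisors ℂ[X]) u
  obtain ⟨d, hd, hd'⟩ := IsLocalization.integerNormalization_spec (nonZeroDivisors ℂ[X]) v
  refine ⟨Polynomial.C d * IsLocalization.integerNormalization (nonZeroDivisors ℂ[X]) u,
    Polynomial.C b * IsLocalization.integerNormalization (nonZeroDivisors ℂ[X]) v, b * d,
    mul_ne_zero (nonZeroDivisors.ne_zero hb) (nonZeroDivisors.ne_zero hd), ?_⟩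
  apply Polynomial.map_injective _ (IsFractionRing.injective ℂ[X] (FractionRing ℂ[X]))
  have e1 : ∀ (b : ℂ[X]) (u : (FractionRing ℂ[X])[X]),
      b • u = Polynomial.C (algebraMap ℂ[X] (FractionRing ℂ[X]) b) * u := by
    intro b u
    rw [← Polynomial.smul_eq_C_mul, algebraMap_smul]
  simp only [e1] at hb' hd'
  simp only [Polynomial.map_add, Polynomial.map_mul, Polynomial.map_C, hb', hd', map_mul]
  linear_combination (Polynomial.C (algebraMap ℂ[X] (FractionRing ℂ[X]) b) *
    Polynomial.C (algebraMap ℂ[X] (FractionRing ℂ[X]) d)) * huv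

/-- A bivariate polynomial as a polynomial in two variables. -/
def bivariateToMv : ℂ[X][Y] →+* MvPolynomial (Fin 2) ℂ :=
  Polynomial.eval₂RingHom (Polynomial.eval₂RingHom MvPolynomial.C (MvPolynomial.X 0))
    (MvPolynomial.X 1)

theorem eval_bivariateToMv (P : ℂ[X][Y]) (y : Fin 2 → ℂ) :
    MvPolynomial.eval y (bivariateToMv P) = P.evalEval (y 0) (y 1) := by
  have : (MvPolynomial.eval y).comp bivariateToMv = Polynomial.evalEvalRingHom (y 0) (y 1) := by
    ext <;> simp [bivariateToMv]
  exact congrArg (fun f => f P) this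

theorem exists_evalEval_eq_eval (g : MvPolynomial (Fin 2) ℂ) :
    ∃ G : ℂ[X][Y], ∀ y : Fin 2 → ℂ, G.evalEval (y 0) (y 1) = MvPolynomial.eval y g := by
  refine ⟨MvPolynomial.aeval ![Polynomial.C Polynomial.X, Polynomial.X] g, fun y => ?_⟩
  have : (Polynomial.evalEvalRingHom (y 0) (y 1)).comp (MvPolynomial.aeval (R := ℂ)
      ![(Polynomial.C Polynomial.X : ℂ[X][Y]), Polynomial.X]).toRingHom = MvPolynomial.eval y := by
    ext i
    · simp
    · fin_cases i <;> simp
  exact congrArg (fun f => f g) this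

/-- The plane curve defined by a bivariate polynomial. -/
def planeZeros (P : ℂ[X][Y]) : Set (EuclideanSpace ℂ (Fin 2)) :=
  {y | P.evalEval (y 0) (y 1) = 0}

theorem mem_planeZeros {P : ℂ[X][Y]} {y : EuclideanSpace ℂ (Fin 2)} :
    y ∈ planeZeros P ↔ P.evalEval (y 0) (y 1) = 0 := Iff.rfl

theorem isComplexAlgebraic_planeZeros (P : ℂ[X][Y]) : IsComplexAlgebraic (planeZeros P) := by
  refine ⟨1, fun _ => bivariateToMv P, ?_⟩
  ext y
  simp [mem_planeZeros, eval_bivariateToMv]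

theorem evalEval_eq_eval_map (P : ℂ[X][Y]) (a b : ℂ) :
    P.evalEval a b = (P.map (Polynomial.evalRingHom a)).eval b := by
  rw [Polynomial.map_evalRingHom_eval]

theorem Polynomial.Monic.exists_evalEval_eq_zero {P : ℂ[X][Y]} (hP : P.Monic)
    (hd : 0 < P.natDegree) (a : ℂ) : ∃ b, P.evalEval a b = 0 := by
  have hm : (P.map (Polynomial.evalRingHom a)).Monic := hP.map _
  obtain ⟨b, hb⟩ := IsAlgClosed.exists_root (P.map (Polynomial.evalRingHom a)) (by
    rw [Polynomial.degree_eq_natDegree hm.ne_zero, hP.natDegree_map]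
    exact_mod_cast hd.ne')
  exact ⟨b, by rwa [evalEval_eq_eval_map]⟩

theorem planeZeros_infinite {P : ℂ[X][Y]} (hP : P.Monic) (hd : 0 < P.natDegree) :
    (planeZeros P).Infinite := by
  intro hfin
  have : (univ : Set ℂ) ⊆ (fun y : EuclideanSpace ℂ (Fin 2) => y 0) '' planeZeros P := by
    intro a _
    obtain ⟨b, hb⟩ := hP.exists_evalEval_eq_zero hd a
    exact ⟨!₂[a, b], by simpa [mem_planeZeros] using hb, by simp⟩
  exact Set.infinite_univ ((hfin.image _).subset this)

/-- A monic irreducible bivariate polynomial and a polynomial which it does not divide have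
finitely many common zeros. -/
theorem planeZeros_inter_finite {f g : ℂ[X][Y]} (hf : f.Monic) (hirr : Irreducible f)
    (hg : ¬ f ∣ g) : (planeZeros f ∩ planeZeros g).Finite := by
  have hcop : IsCoprime (f.map (algebraMap ℂ[X] (FractionRing ℂ[X])))
      (g.map (algebraMap ℂ[X] (FractionRing ℂ[X]))) := by
    refine ((hf.irreducible_iff_irreducible_map_fraction_map.1 hirr).coprime_iff_not_dvd).2 ?_
    rwa [Polynomial.map_dvd_map _ (IsFractionRing.injective _ _) hf]
  obtain ⟨u, v, c, hc, huv⟩ := exists_mul_add_mul_eq_C hcop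
  have hfib : ∀ a : ℂ, ((f.map (Polynomial.evalRingHom a)).rootSet ℂ).Finite :=
    fun a => Polynomial.rootSet_finite _ _
  refine Set.Finite.subset (s := ⋃ a ∈ c.rootSet ℂ,
    (fun b => !₂[a, b]) '' ((f.map (Polynomial.evalRingHom a)).rootSet ℂ))
    ((Polynomial.rootSet_finite c ℂ).biUnion fun a _ => (hfib a).image _) ?_
  rintro y ⟨hyf, hyg⟩
  have h0 : c.eval (y 0) = 0 := by
    have := congrArg (Polynomial.evalEval (y 0) (y 1)) huv
    rw [Polynomial.evalEval_add, Polynomial.evalEval_mul, Polynomial.evalEval_mul,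
      mem_planeZeros.1 hyf, mem_planeZeros.1 hyg, Polynomial.evalEval_C] at this
    simpa using this.symm
  refine mem_iUnion₂.2 ⟨y 0, ?_, y 1, ?_, ?_⟩
  · simp [Polynomial.mem_rootSet, hc, h0]
  · rw [Polynomial.mem_rootSet]
    refine ⟨(hf.map _).ne_zero, ?_⟩
    rw [Polynomial.coe_aeval_eq_eval, ← evalEval_eq_eval_map]
    exact hyf
  · ext i
    fin_cases i <;> simp

theorem IsComplexAlgebraic.finite_of_ssubset_planeZeros {f : ℂ[X][Y]} (hf : f.Monic)
    (hirr : Irreducible f) {A : Set (EuclideanSpace ℂ (Fin 2))} (hA : IsComplexAlgebraic A)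
    (hlt : A ⊂ planeZeros f) : A.Finite := by
  obtain ⟨m, P, rfl⟩ := hA
  obtain ⟨y, hyf, hy⟩ := Set.exists_of_ssubset hlt
  simp only [mem_ofPred_eq, not_forall] at hy
  obtain ⟨i, hi⟩ := hy
  obtain ⟨G, hG⟩ := exists_evalEval_eq_eval (P i)
  refine (planeZeros_inter_finite hf hirr (g := G) ?_).subset fun x hx => ⟨hlt.1 hx, ?_⟩
  · rintro ⟨k, rfl⟩
    refine hi ?_
    rw [← hG, Polynomial.evalEval_mul, mem_planeZeros.1 hyf, zero_mul]
  · rw [mem_planeZeros]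
    exact (hG _).trans (hx i)

theorem isIrreducibleAlg_planeZeros {f : ℂ[X][Y]} (hf : f.Monic) (hirr : Irreducible f) :
    IsIrreducibleAlg (planeZeros f) := by
  have hd : 0 < f.natDegree := hf.natDegree_pos_of_not_isUnit hirr.not_isUnit
  have hinf := planeZeros_infinite hf hd
  refine ⟨hinf.nonempty, isComplexAlgebraic_planeZeros f, fun A B hA hB h => ?_⟩
  by_contra! hne
  have hAf := hA.finite_of_ssubset_planeZeros hf hirr
    ((h ▸ subset_union_left : A ⊆ planeZeros f).ssubset_of_ne hne.1.symm)
  have hBf := hB.finite_of_ssubset_planeZeros hf hirr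
    ((h ▸ subset_union_right : B ⊆ planeZeros f).ssubset_of_ne hne.2.symm)
  exact hinf (h ▸ hAf.union hBf)

theorem hasAlgDim_planeZeros {f : ℂ[X][Y]} (hf : f.Monic) (hirr : Irreducible f) :
    HasAlgDim (planeZeros f) 1 := by
  have hI := isIrreducibleAlg_planeZeros hf hirr
  have hinf := planeZeros_infinite hf (hf.natDegree_pos_of_not_isUnit hirr.not_isUnit)
  constructor
  · obtain ⟨y, hy⟩ := hI.1
    refine ⟨![{y}, planeZeros f], ?_, ?_, rfl⟩
    · intro i
      fin_cases i
      · exact isIrreducibleAlg_singleton y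
      · exact hI
    · rw [Fin.strictMono_iff_lt_succ]
      intro i
      fin_cases i
      refine (singleton_subset_iff.2 hy).ssubset_of_ne fun h => hinf ?_
      exact h ▸ finite_singleton y
  · rintro ⟨F, hF, hmono, hlast⟩
    have h1 : F 1 < planeZeros f := hlast ▸ hmono (by decide)
    have h0 : F 0 < F 1 := hmono (by decide)
    have hs := (hF 1).subsingleton_of_finite ((hF 1).2.1.finite_of_ssubset_planeZeros hf hirr h1)
    obtain ⟨x, hx⟩ := (hF 0).1
    refine h0.2 fun y hy => ?_
    rwa [hs hy (h0.1 hx)]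

theorem IsIrreducibleAlg.exists_subset_planeZeros {C : Set (EuclideanSpace ℂ (Fin 2))}
    (hC : IsIrreducibleAlg C) (N : ℕ) : ∀ P : ℂ[X][Y], P.Monic → P.natDegree ≤ N →
      C ⊆ planeZeros P →
      ∃ f : ℂ[X][Y], f.Monic ∧ Irreducible f ∧ C ⊆ planeZeros f ∧ planeZeros f ⊆ planeZeros P := by
  induction N with
  | zero =>
    intro P hP hd hsub
    obtain ⟨x, hx⟩ := hC.1
    have h1 : P = 1 := hP.natDegree_eq_zero.1 (Nat.le_zero.1 hd)
    have := mem_planeZeros.1 (hsub hx)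
    simp [h1] at this
  | succ N ih =>
    intro P hP hd hsub
    by_cases hirr : Irreducible P
    · exact ⟨P, hP, hirr, hsub, Subset.rfl⟩
    by_cases h1 : P = 1
    · obtain ⟨x, hx⟩ := hC.1
      have := mem_planeZeros.1 (hsub hx)
      simp [h1] at this
    rw [hP.irreducible_iff_natDegree'] at hirr
    push Not at hirr
    obtain ⟨f, g, hf, hg, rfl, hmem⟩ := hirr h1
    rw [hf.natDegree_mul hg] at hmem hd
    rw [Finset.mem_Ioc] at hmem
    have key := hC.eval_eq_zero_or (f := bivariateToMv f) (g := bivariateToMv g) (by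
      intro x hx
      rw [eval_bivariateToMv, eval_bivariateToMv, ← Polynomial.evalEval_mul]
      exact hsub hx)
    simp only [eval_bivariateToMv] at key
    rcases key with h | h
    · obtain ⟨k, hk, hki, h1, h2⟩ := ih f hf (by omega) h
      refine ⟨k, hk, hki, h1, h2.trans fun x hx => ?_⟩
      rw [mem_planeZeros, Polynomial.evalEval_mul, mem_planeZeros.1 hx, zero_mul]
    · obtain ⟨k, hk, hki, h1, h2⟩ := ih g hg (by omega) h
      refine ⟨k, hk, hki, h1, h2.trans fun x hx => ?_⟩
      rw [mem_planeZeros, Polynomial.evalEval_mul, mem_planeZeros.1 hx, mul_zero]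

theorem isComplexAlgebraicCurve_planeZeros {P : ℂ[X][Y]} (hP : P.Monic) (hd : 0 < P.natDegree) :
    IsComplexAlgebraicCurve (planeZeros P) := by
  refine ⟨isComplexAlgebraic_planeZeros P, (planeZeros_infinite hP hd).nonempty, ?_⟩
  rintro C ⟨hC, hsub, hmax⟩
  obtain ⟨f, hf, hirr, hCf, hfP⟩ := hC.exists_subset_planeZeros _ P hP le_rfl hsub
  rw [hmax _ (isIrreducibleAlg_planeZeros hf hirr) hfP hCf]
  exact hasAlgDim_planeZeros hf hirr

end PlaneCurves

/-- A domain of finite type over a field containing two algebraically independent elements has a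
chain of three prime ideals. -/
theorem AlgebraicIndependent.exists_prime_chain {k A : Type} [Field k] [CommRing A] [IsDomain A]
    [Algebra k A] [Algebra.FiniteType k A] {x : Fin 2 → A} (hx : AlgebraicIndependent k x) :
    ∃ q₀ q₁ q₂ : Ideal A, q₀.IsPrime ∧ q₁.IsPrime ∧ q₂.IsPrime ∧ q₀ < q₁ ∧ q₁ < q₂ := by
  obtain ⟨s, g, hinj, hintegral⟩ := exists_integral_inj_algHom_of_fg k A
  algebraize [g.toRingHom]
  have : FaithfulSMul (MvPolynomial (Fin s) k) A := by
    rw [faithfulSMul_iff_algebraMap_injective]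
    exact hinj
  have hs : 2 ≤ s := by
    have h1 := hx.cardinalMk_le_trdeg
    rw [← trdeg_add_eq k (S := MvPolynomial (Fin s) k) (A := A), trdeg_eq_zero (R := MvPolynomial (Fin s) k),
      MvPolynomial.trdeg_of_isDomain] at h1
    simpa using h1
  have hdim : ((2 : ℕ) : WithBot ℕ∞) ≤ ringKrullDim (MvPolynomial (Fin s) k) := by
    rw [MvPolynomial.ringKrullDim_of_isNoetherianRing, ringKrullDim_eq_zero_of_field]
    simpa using hs
  obtain ⟨l, hl⟩ := Order.le_krullDim_iff.1 hdim
  have h01 : l ⟨0, by omega⟩ < l ⟨1, by omega⟩ := l.strictMono (by simp [Fin.lt_def])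
  have h12 : l ⟨1, by omega⟩ < l ⟨2, by omega⟩ := l.strictMono (by simp [Fin.lt_def])
  obtain ⟨q₀, -, hq₀, e₀⟩ := Ideal.exists_ideal_over_prime_of_isIntegral
    (S := A) (l ⟨0, by omega⟩).asIdeal ⊥ (by
      rw [← RingHom.ker_eq_comap_bot (algebraMap (MvPolynomial (Fin s) k) A),
        (RingHom.injective_iff_ker_eq_bot
        (algebraMap (MvPolynomial (Fin s) k) A)).1 hinj]
      exact bot_le)
  obtain ⟨q₁, h1, hq₁, e₁⟩ := Ideal.exists_ideal_over_prime_of_isIntegral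
    (S := A) (l ⟨1, by omega⟩).asIdeal q₀ (by rw [e₀]; exact h01.le)
  obtain ⟨q₂, h2, hq₂, e₂⟩ := Ideal.exists_ideal_over_prime_of_isIntegral
    (S := A) (l ⟨2, by omega⟩).asIdeal q₁ (by rw [e₁]; exact h12.le)
  refine ⟨q₀, q₁, q₂, hq₀, hq₁, hq₂, h1.lt_of_ne ?_, h2.lt_of_ne ?_⟩
  · rintro rfl
    exact h01.ne (PrimeSpectrum.ext (e₀.symm.trans e₁))
  · rintro rfl
    exact h12.ne (PrimeSpectrum.ext (e₁.symm.trans e₂))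

section Components

variable {n : ℕ}

/-- The common zeros of the polynomials in an ideal. -/
def idealZeros (I : Ideal (MvPolynomial (Fin n) ℂ)) : Set (EuclideanSpace ℂ (Fin n)) :=
  {x | ∀ f ∈ I, MvPolynomial.eval (fun j => x j) f = 0}

/-- The ideal of the polynomials vanishing on a set. -/
def idealOf (S : Set (EuclideanSpace ℂ (Fin n))) : Ideal (MvPolynomial (Fin n) ℂ) where
  carrier := {f | ∀ x ∈ S, MvPolynomial.eval (fun j => x j) f = 0}
  zero_mem' _ _ := map_zero _
  add_mem' hp hq x hx := by rw [map_add, hp x hx, hq x hx, add_zero]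
  smul_mem' p q hq x hx := by rw [smul_eq_mul, map_mul, hq x hx, mul_zero]

theorem mem_idealZeros {I : Ideal (MvPolynomial (Fin n) ℂ)} {x : EuclideanSpace ℂ (Fin n)} :
    x ∈ idealZeros I ↔ ∀ f ∈ I, MvPolynomial.eval (fun j => x j) f = 0 := Iff.rfl

theorem mem_idealOf {S : Set (EuclideanSpace ℂ (Fin n))} {f : MvPolynomial (Fin n) ℂ} :
    f ∈ idealOf S ↔ ∀ x ∈ S, MvPolynomial.eval (fun j => x j) f = 0 := Iff.rfl

theorem isComplexAlgebraic_idealZeros (I : Ideal (MvPolynomial (Fin n) ℂ)) :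
    IsComplexAlgebraic (idealZeros I) := by
  obtain ⟨s, rfl⟩ := (isNoetherianRing_iff_ideal_fg _).1 inferInstance I
  refine ⟨s.card, fun i => s.equivFin.symm i, ?_⟩
  ext x
  constructor
  · exact fun h i => h _ (Ideal.subset_span (s.equivFin.symm i).2)
  · intro h
    have : Ideal.span (s : Set (MvPolynomial (Fin n) ℂ)) ≤
        RingHom.ker (MvPolynomial.eval (fun j => x j)) := by
      rw [Ideal.span_le]
      intro f hf
      simpa using h (s.equivFin ⟨f, hf⟩)
    exact fun f hf => this hf

theorem IsComplexAlgebraic.idealZeros_idealOf {X : Set (EuclideanSpace ℂ (Fin n))}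
    (hX : IsComplexAlgebraic X) : idealZeros (idealOf X) = X := by
  refine Subset.antisymm ?_ fun x hx f hf => hf x hx
  obtain ⟨m, P, rfl⟩ := hX
  exact fun x hx i => hx _ fun y hy => hy i

theorem idealOf_idealZeros (p : Ideal (MvPolynomial (Fin n) ℂ)) [hp : p.IsPrime] :
    idealOf (idealZeros p) = p := by
  conv_rhs => rw [← MvPolynomial.IsPrime.vanishingIdeal_zeroLocus (K := ℂ) p]
  ext f
  simp only [mem_idealOf, mem_idealZeros, MvPolynomial.mem_vanishingIdeal_iff,
    MvPolynomial.mem_zeroLocus_iff]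
  exact ⟨fun h x hx => h (WithLp.toLp 2 x) hx, fun h x hx => h _ hx⟩

theorem idealOf_anti {S T : Set (EuclideanSpace ℂ (Fin n))} (h : S ⊆ T) :
    idealOf T ≤ idealOf S := fun _ hf x hx => hf x (h hx)

theorem idealZeros_anti {I J : Ideal (MvPolynomial (Fin n) ℂ)} (h : I ≤ J) :
    idealZeros J ⊆ idealZeros I := fun _ hx f hf => hx f (h hf)

theorem IsIrreducibleAlg.idealOf_isPrime {C : Set (EuclideanSpace ℂ (Fin n))}
    (hC : IsIrreducibleAlg C) : (idealOf C).IsPrime := by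
  refine Ideal.isPrime_iff.2 ⟨fun h => ?_, fun {f g} h => hC.eval_eq_zero_or fun x hx => by
    simpa using h x hx⟩
  obtain ⟨x, hx⟩ := hC.1
  have h1 : (1 : MvPolynomial (Fin n) ℂ) ∈ idealOf C := h ▸ Submodule.mem_top
  simpa using h1 x hx

theorem isIrreducibleAlg_idealZeros (p : Ideal (MvPolynomial (Fin n) ℂ)) [hp : p.IsPrime] :
    IsIrreducibleAlg (idealZeros p) := by
  refine ⟨?_, isComplexAlgebraic_idealZeros p, fun A B hA hB h => ?_⟩
  · by_contra hne
    rw [not_nonempty_iff_eq_empty] at hne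
    refine hp.ne_top ?_
    rw [← idealOf_idealZeros p, hne, Ideal.eq_top_iff_one]
    exact fun x hx => absurd hx (notMem_empty x)
  · have hA' : A ⊆ idealZeros p := h ▸ subset_union_left
    have hB' : B ⊆ idealZeros p := h ▸ subset_union_right
    have hmul : idealOf A * idealOf B ≤ p := by
      rw [Ideal.mul_le]
      intro f hf g hg
      rw [← idealOf_idealZeros p, h]
      rintro x (hx | hx)
      · rw [map_mul, hf x hx, zero_mul]
      · rw [map_mul, hg x hx, mul_zero]
    rcases hp.mul_le.1 hmul with h | h
    · refine Or.inl (Subset.antisymm ?_ hA')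
      rw [← hA.idealZeros_idealOf]
      exact idealZeros_anti h
    · refine Or.inr (Subset.antisymm ?_ hB')
      rw [← hB.idealZeros_idealOf]
      exact idealZeros_anti h

theorem IsComplexAlgebraic.isIrredComponent {X : Set (EuclideanSpace ℂ (Fin n))}
    (hX : IsComplexAlgebraic X) {p : Ideal (MvPolynomial (Fin n) ℂ)}
    (hp : p ∈ (idealOf X).minimalPrimes) : IsIrredComponent (idealZeros p) X := by
  have := hp.1.1
  refine ⟨isIrreducibleAlg_idealZeros p, ?_, fun C hC hCX hpC => Subset.antisymm hpC ?_⟩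
  · conv_rhs => rw [← hX.idealZeros_idealOf]
    exact idealZeros_anti hp.1.2
  · rw [← hC.2.1.idealZeros_idealOf]
    refine idealZeros_anti (hp.2 ⟨hC.idealOf_isPrime, idealOf_anti hCX⟩ ?_)
    conv_rhs => rw [← idealOf_idealZeros p]
    exact idealOf_anti hpC

theorem IsComplexAlgebraic.exists_component {X : Set (EuclideanSpace ℂ (Fin n))}
    (hX : IsComplexAlgebraic X) {x : EuclideanSpace ℂ (Fin n)} (hx : x ∈ X) :
    ∃ C, IsIrredComponent C X ∧ x ∈ C := by
  have := (isIrreducibleAlg_singleton x).idealOf_isPrime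
  obtain ⟨p, hp, hpx⟩ := Ideal.exists_minimalPrimes_le
    (idealOf_anti (singleton_subset_iff.2 hx))
  refine ⟨_, hX.isIrredComponent hp, ?_⟩
  have h := idealZeros_anti hpx
  rw [(isComplexAlgebraic_singleton x).idealZeros_idealOf] at h
  exact h rfl

theorem HasAlgDim.not_prime_chain {p : Ideal (MvPolynomial (Fin n) ℂ)} [hp : p.IsPrime]
    (h : HasAlgDim (idealZeros p) 1) {q r : Ideal (MvPolynomial (Fin n) ℂ)} (hq : q.IsPrime)
    (hr : r.IsPrime) (hpq : p < q) (hqr : q < r) : False := by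
  have key : ∀ {a b : Ideal (MvPolynomial (Fin n) ℂ)}, a.IsPrime → b.IsPrime → a < b →
      idealZeros b < idealZeros a := by
    intro a b ha hb hab
    refine lt_of_le_of_ne (idealZeros_anti hab.le) fun h => hab.ne ?_
    rw [← idealOf_idealZeros a, ← idealOf_idealZeros b, h]
  refine h.2 ⟨![idealZeros r, idealZeros q, idealZeros p], ?_, ?_, rfl⟩
  · intro i
    fin_cases i
    · exact isIrreducibleAlg_idealZeros r
    · exact isIrreducibleAlg_idealZeros q
    · exact isIrreducibleAlg_idealZeros p
  · rw [Fin.strictMono_iff_lt_succ]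
    intro i
    fin_cases i
    · exact key hq hr hqr
    · exact key hp hq hpq

/-- Any two polynomials are algebraically dependent on an algebraic curve. -/
theorem IsComplexAlgebraicCurve.exists_dependence {X : Set (EuclideanSpace ℂ (Fin n))}
    (hX : IsComplexAlgebraicCurve X) (a : Fin 2 → MvPolynomial (Fin n) ℂ) :
    ∃ F : MvPolynomial (Fin 2) ℂ, F ≠ 0 ∧ ∀ x ∈ X,
      MvPolynomial.eval (fun i => MvPolynomial.eval (fun j => x j) (a i)) F = 0 := by
  have hfin := Ideal.finite_minimalPrimes_of_isNoetherianRing _ (idealOf X)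
  have hp : ∀ p ∈ (idealOf X).minimalPrimes, ∃ F : MvPolynomial (Fin 2) ℂ, F ≠ 0 ∧
      MvPolynomial.aeval a F ∈ p := by
    intro p hp
    have := hp.1.1
    by_contra! hF
    have hind : AlgebraicIndependent ℂ (fun i => Ideal.Quotient.mkₐ ℂ p (a i)) := by
      rw [algebraicIndependent_iff]
      intro F hF0
      by_contra hne
      refine hF F hne ?_
      rw [← Ideal.Quotient.eq_zero_iff_mem, ← Ideal.Quotient.mkₐ_eq_mk ℂ,
        ← hF0]
      exact MvPolynomial.comp_aeval_apply a _ F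
    obtain ⟨q₀, q₁, q₂, h₀, h₁, h₂, h01, h12⟩ := hind.exists_prime_chain
    have hlt : ∀ {q r : Ideal (MvPolynomial (Fin n) ℂ ⧸ p)}, q < r →
        q.comap (Ideal.Quotient.mk p) < r.comap (Ideal.Quotient.mk p) :=
      fun {q r} h => (Ideal.comap_mono h.le).lt_of_ne fun h' => h.ne
        (Ideal.comap_injective_of_surjective _ Ideal.Quotient.mk_surjective h')
    have hpq : p ≤ q₀.comap (Ideal.Quotient.mk p) := by
      conv_lhs => rw [← Ideal.mk_ker (I := p)]
      exact Ideal.ker_le_comap _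
    exact (hX.2.2 _ (hX.1.isIrredComponent hp)).not_prime_chain
      (Ideal.comap_isPrime _ q₁) (Ideal.comap_isPrime _ q₂) (hpq.trans_lt (hlt h01)) (hlt h12)
  choose! F hF0 hF using hp
  refine ⟨∏ p ∈ hfin.toFinset, F p, Finset.prod_ne_zero_iff.2 fun p hp => hF0 p (by simpa using hp),
    fun x hx => ?_⟩
  have := (isIrreducibleAlg_singleton x).idealOf_isPrime
  obtain ⟨p, hp, hpx⟩ := Ideal.exists_minimalPrimes_le (idealOf_anti (singleton_subset_iff.2 hx))
  have h0 := hpx (hF p hp) x rfl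
  rw [map_prod, Finset.prod_eq_zero (hfin.mem_toFinset.2 hp)]
  rw [← h0, MvPolynomial.aeval_def, MvPolynomial.eval₂_eq, MvPolynomial.eval_eq]
  simp

/-- If a product of two polynomials vanishes on an algebraic curve and the first one has finitely
many zeros there, the second one vanishes on the curve. -/
theorem IsComplexAlgebraicCurve.eval_eq_zero_of_mul {X : Set (EuclideanSpace ℂ (Fin n))}
    (hX : IsComplexAlgebraicCurve X) {f g : MvPolynomial (Fin n) ℂ}
    (hfin : {x ∈ X | MvPolynomial.eval (fun j => x j) f = 0}.Finite)
    (h : ∀ x ∈ X, MvPolynomial.eval (fun j => x j) f * MvPolynomial.eval (fun j => x j) g = 0) :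
    ∀ x ∈ X, MvPolynomial.eval (fun j => x j) g = 0 := by
  intro x hx
  obtain ⟨C, hC, hxC⟩ := hX.1.exists_component hx
  rcases hC.1.eval_eq_zero_or (fun y hy => h y (hC.2.1 hy)) with h | h
  · exact absurd (hfin.subset fun y hy => ⟨hC.2.1 hy, h y hy⟩) (hX.2.2 C hC).infinite
  · exact h x hxC

end Components

section Homogeneous

open MvPolynomial

theorem MvPolynomial.IsHomogeneous.eval_mul_const {σ : Type*} [Fintype σ]
    {T : MvPolynomial σ ℂ} {d : ℕ}
    (hT : T.IsHomogeneous d) (c : ℂ) (v : σ → ℂ) :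
    eval (fun i => c * v i) T = c ^ d * eval v T := by
  rw [eval_eq', eval_eq', Finset.mul_sum]
  refine Finset.sum_congr rfl fun m hm => ?_
  have hd : ∑ i, m i = d := by
    rw [← hT (mem_support_iff.1 hm), Finsupp.weight_apply, Finsupp.sum_fintype _ _ (by simp)]
    simp
  simp only [mul_pow, Finset.prod_mul_distrib, Finset.prod_pow_eq_pow_sum, hd]
  ring

/-- The values of a polynomial along a sequence tending to infinity are asymptotically given by
its top homogeneous component. -/
theorem MvPolynomial.tendsto_eval_div_pow_totalDegree {σ ι : Type*} [Fintype σ]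
    (F : MvPolynomial σ ℂ) {l : Filter ι} {p : ι → σ → ℂ} {t : ι → ℂ} {v : σ → ℂ}
    (ht : Tendsto (fun k => ‖t k‖) l atTop)
    (hp : ∀ i, Tendsto (fun k => (t k)⁻¹ * p k i) l (𝓝 (v i))) :
    Tendsto (fun k => (t k)⁻¹ ^ F.totalDegree * eval (p k) F) l
      (𝓝 (eval v (homogeneousComponent F.totalDegree F))) := by
  have ht0 : ∀ᶠ k in l, t k ≠ 0 := by
    filter_upwards [ht.eventually_gt_atTop 0] with k hk
    exact norm_pos_iff.1 hk
  have hinv : Tendsto (fun k => (t k)⁻¹) l (𝓝 0) := by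
    rw [tendsto_zero_iff_norm_tendsto_zero]
    simp only [norm_inv]
    exact tendsto_inv_atTop_zero.comp ht
  have hv : ∀ G : MvPolynomial σ ℂ, Tendsto (fun k => eval (fun i => (t k)⁻¹ * p k i) G) l
      (𝓝 (eval v G)) := fun G =>
    ((MvPolynomial.continuous_eval G).tendsto v).comp (tendsto_pi_nhds.2 hp)
  have key : (fun k => ∑ j ∈ Finset.range (F.totalDegree + 1), (t k)⁻¹ ^ (F.totalDegree - j) *
      eval (fun i => (t k)⁻¹ * p k i) (homogeneousComponent j F)) =ᶠ[l]
      fun k => (t k)⁻¹ ^ F.totalDegree * eval (p k) F := by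
    filter_upwards [ht0] with k hk
    have hsum : eval (p k) F = ∑ j ∈ Finset.range (F.totalDegree + 1),
        eval (p k) (homogeneousComponent j F) := by
      rw [← map_sum, sum_homogeneousComponent]
    rw [hsum, Finset.mul_sum]
    refine Finset.sum_congr rfl fun j hj => ?_
    rw [(homogeneousComponent_isHomogeneous j F).eval_mul_const, ← mul_assoc, ← pow_add,
      Nat.sub_add_cancel (Nat.lt_succ_iff.1 (Finset.mem_range.1 hj))]
  refine Tendsto.congr' key ?_
  have hlim : eval v (homogeneousComponent F.totalDegree F) =
      ∑ j ∈ Finset.range (F.totalDegree + 1), (if j = F.totalDegree then 1 else 0) *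
        eval v (homogeneousComponent j F) := by
    simp [Finset.sum_ite_eq']
  rw [hlim]
  refine tendsto_finsetSum _ fun j hj => ?_
  refine Tendsto.mul ?_ (hv _)
  split_ifs with h
  · simpa [h] using tendsto_const_nhds
  · have : F.totalDegree - j ≠ 0 := by
      have := Finset.mem_range.1 hj
      omega
    simpa [this] using hinv.pow (F.totalDegree - j)

theorem MvPolynomial.homogeneousComponent_totalDegree_ne_zero {σ : Type*} {F : MvPolynomial σ ℂ}
    (hF : F ≠ 0) : homogeneousComponent F.totalDegree F ≠ 0 := by
  obtain ⟨m, hm, hd⟩ := Finset.exists_mem_eq_sup F.support (support_nonempty.2 hF)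
    fun s => s.sum fun _ e => e
  have hd' : m.degree = F.totalDegree := hd.symm
  intro h
  have := congrArg (coeff m) h
  rw [coeff_homogeneousComponent, if_pos hd', coeff_zero] at this
  exact mem_support_iff.1 hm this

/-- A nonzero binary form has finitely many zeros with first coordinate one. -/
theorem MvPolynomial.IsHomogeneous.finite_zeros {T : MvPolynomial (Fin 2) ℂ} {d : ℕ}
    (hT : T.IsHomogeneous d) (h0 : T ≠ 0) : {w : ℂ | eval ![1, w] T = 0}.Finite := by
  have heval : ∀ w, (MvPolynomial.aeval ![1, Polynomial.X] T : Polynomial ℂ).eval w = eval ![1, w] T := by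
    intro w
    have : (Polynomial.evalRingHom w).comp (MvPolynomial.aeval (R := ℂ)
        ![(1 : Polynomial ℂ), Polynomial.X]).toRingHom = eval ![1, w] := by
      ext i
      · simp
      · fin_cases i <;> simp
    exact congrArg (fun f => f T) this
  have hne : (MvPolynomial.aeval ![1, Polynomial.X] T : Polynomial ℂ) ≠ 0 := by
    intro h
    have hz : ∀ w, eval ![1, w] T = 0 := fun w => by rw [← heval, h, Polynomial.eval_zero]
    have : X 0 * T = 0 := by
      refine MvPolynomial.funext fun v => ?_
      rw [map_mul, map_zero, eval_X]
      by_cases hv : v 0 = 0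
      · rw [hv, zero_mul]
      · have e : v = fun i => v 0 * (![1, v 1 / v 0] : Fin 2 → ℂ) i := by
          ext i
          fin_cases i
          · simp
          · simp [mul_div_cancel₀ _ hv]
        rw [e, hT.eval_mul_const, hz, mul_zero, mul_zero]
    exact h0 ((mul_eq_zero.1 this).resolve_left (X_ne_zero 0))
  refine (Polynomial.rootSet_finite (MvPolynomial.aeval ![1, Polynomial.X] T : Polynomial ℂ) ℂ).subset
    fun w hw => ?_
  rw [Polynomial.mem_rootSet]
  exact ⟨hne, by rw [Polynomial.coe_aeval_eq_eval, heval]; exact hw⟩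

theorem MvPolynomial.natDegree_aeval_le {R : Type*} [CommRing R] [Algebra ℂ R]
    (F : MvPolynomial (Fin 2) ℂ) {p : Fin 2 → Polynomial R} (hp : ∀ i, (p i).natDegree ≤ 1) :
    (aeval p F).natDegree ≤ F.totalDegree := by
  rw [aeval_def, eval₂_eq']
  refine Polynomial.natDegree_sum_le_of_forall_le _ _ fun m hm => ?_
  have hm' : m 0 + m 1 ≤ F.totalDegree := by
    have := le_totalDegree hm
    rwa [Finsupp.sum_fintype _ _ (by simp), Fin.sum_univ_two] at this
  rw [Fin.prod_univ_two, Polynomial.algebraMap_apply]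
  refine (Polynomial.natDegree_C_mul_le _ _).trans ((Polynomial.natDegree_mul_le).trans ?_)
  have h0 := Polynomial.natDegree_pow_le_of_le (m 0) (hp 0)
  have h1 := Polynomial.natDegree_pow_le_of_le (m 1) (hp 1)
  omega

/-- Substituting polynomials of degree at most one, the top coefficient is the value of the top
homogeneous component at the leading coefficients. -/
theorem MvPolynomial.coeff_aeval_totalDegree {R : Type*} [CommRing R] [Algebra ℂ R]
    (F : MvPolynomial (Fin 2) ℂ) {p : Fin 2 → Polynomial R} (hp : ∀ i, (p i).natDegree ≤ 1) :
    (aeval p F).coeff F.totalDegree =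
      aeval (fun i => (p i).coeff 1) (homogeneousComponent F.totalDegree F) := by
  rw [homogeneousComponent_apply, map_sum, Finset.sum_filter, aeval_def, eval₂_eq',
    Polynomial.finsetSum_coeff]
  refine Finset.sum_congr rfl fun m hm => ?_
  have hm' : m 0 + m 1 ≤ F.totalDegree := by
    have := le_totalDegree hm
    rwa [Finsupp.sum_fintype _ _ (by simp), Fin.sum_univ_two] at this
  have hdeg : m.degree = m 0 + m 1 := by
    rw [Finsupp.degree_eq_sum, Fin.sum_univ_two]
  have h0 := Polynomial.natDegree_pow_le_of_le (m 0) (hp 0)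
  have h1 := Polynomial.natDegree_pow_le_of_le (m 1) (hp 1)
  rw [Fin.prod_univ_two, Polynomial.algebraMap_apply, Polynomial.coeff_C_mul, hdeg]
  split_ifs with h
  · have e0 := Polynomial.coeff_pow_of_natDegree_le (m := m 0) (hp 0)
    have e1 := Polynomial.coeff_pow_of_natDegree_le (m := m 1) (hp 1)
    rw [mul_one] at h0 h1 e0 e1
    rw [← h, Polynomial.coeff_mul_add_eq_of_natDegree_le h0 h1, e0, e1, aeval_monomial,
      Finsupp.prod_fintype _ _ (by simp), Fin.prod_univ_two]
  · rw [Polynomial.coeff_eq_zero_of_natDegree_lt, mul_zero]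
    refine Polynomial.natDegree_mul_le.trans_lt ?_
    omega

end Homogeneous

section Projection

open scoped Polynomial Polynomial.Bivariate

variable {n : ℕ}

/-- A linear form as a polynomial. -/
def linearFormPoly (a : EuclideanSpace ℂ (Fin n) →ₗ[ℂ] ℂ) : MvPolynomial (Fin n) ℂ :=
  ∑ i, MvPolynomial.C (a (EuclideanSpace.single i 1)) * MvPolynomial.X i

theorem eval_linearFormPoly (a : EuclideanSpace ℂ (Fin n) →ₗ[ℂ] ℂ)
    (x : EuclideanSpace ℂ (Fin n)) :
    MvPolynomial.eval (fun j => x j) (linearFormPoly a) = a x := by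
  conv_rhs => rw [← (EuclideanSpace.basisFun (Fin n) ℂ).sum_repr x]
  simp [linearFormPoly, mul_comm]

theorem IsComplexAlgebraicCurve.exists_linear_dependence {X : Set (EuclideanSpace ℂ (Fin n))}
    (hX : IsComplexAlgebraicCurve X) (a b : EuclideanSpace ℂ (Fin n) →ₗ[ℂ] ℂ) :
    ∃ F : MvPolynomial (Fin 2) ℂ, F ≠ 0 ∧ ∀ x ∈ X, MvPolynomial.eval ![a x, b x] F = 0 := by
  obtain ⟨F, hF, h⟩ := hX.exists_dependence ![linearFormPoly a, linearFormPoly b]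
  refine ⟨F, hF, fun x hx => ?_⟩
  rw [← h x hx]
  congr 2
  ext i
  fin_cases i <;> simp [eval_linearFormPoly]

/-- The function `f` satisfies on `X` a monic polynomial equation with coefficients polynomials
in the function `g`. -/
def IntegralOver {V : Type*} (X : Set V) (g f : V → ℂ) : Prop :=
  ∃ F : ℂ[X][Y], F.Monic ∧ ∀ x ∈ X, F.evalEval (g x) (f x) = 0

/-- The ring homomorphism sending a polynomial to its composition with a function. -/
def compHom {V : Type*} (X : Set V) (g : V → ℂ) : ℂ[X] →+* (X → ℂ) :=
  RingHom.pi fun x => Polynomial.evalRingHom (g x)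

@[simp]
theorem compHom_apply {V : Type*} (X : Set V) (g : V → ℂ) (p : ℂ[X]) (x : X) :
    compHom X g p x = p.eval (g x) := rfl

theorem eval₂_compHom {V : Type*} (X : Set V) (g : V → ℂ) (f : X → ℂ) (F : ℂ[X][Y]) (x : X) :
    F.eval₂ (compHom X g) f x = F.evalEval (g x) (f x) := by
  have h : (Pi.evalRingHom (fun _ : X => ℂ) x).comp (Polynomial.eval₂RingHom (compHom X g) f) =
      Polynomial.evalEvalRingHom (g x) (f x) := by
    ext <;> simp
  exact congrArg (fun φ => φ F) h

theorem integralOver_iff {V : Type*} {X : Set V} {g f : V → ℂ} :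
    IntegralOver X g f ↔ (compHom X g).IsIntegralElem (fun x : X => f x) := by
  refine exists_congr fun F => and_congr_right fun _ => ?_
  rw [funext_iff, SetCoe.forall]
  refine forall₂_congr fun x hx => ?_
  rw [← eval₂_compHom X g (fun x : X => f x) F ⟨x, hx⟩]
  rfl

theorem IntegralOver.trans {V : Type*} {X : Set V} {g f h : V → ℂ} (hf : IntegralOver X g f)
    (hh : IntegralOver X f h) : IntegralOver X g h := by
  rw [integralOver_iff] at hf
  let _ : Algebra ℂ[X] (X → ℂ) := (compHom X g).toAlgebra
  let B := integralClosure ℂ[X] (X → ℂ)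
  have hB : ∀ p : ℂ[X], compHom X f p ∈ B := by
    intro p
    induction p using Polynomial.induction_on' with
    | add p q hp hq =>
      rw [map_add]
      exact B.add_mem hp hq
    | monomial k c =>
      have : compHom X f (Polynomial.monomial k c) =
          algebraMap ℂ[X] (X → ℂ) (Polynomial.C c) * (fun x : X => f x) ^ k := by
        ext x
        simp [RingHom.algebraMap_toAlgebra]
      rw [this]
      exact B.mul_mem (B.algebraMap_mem _) (B.pow_mem hf k)
  obtain ⟨F, hF, hF0⟩ := integralOver_iff.1 hh
  have hintegral : IsIntegral B (fun x : X => h x) := by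
    refine ⟨F.map ((compHom X f).codRestrict B.toSubring hB), hF.map _, ?_⟩
    rw [Polynomial.eval₂_map]
    exact hF0
  exact integralOver_iff.2 (isIntegral_trans (R := ℂ[X]) (A := B) _ hintegral)

theorem IntegralOver.add {V : Type*} {X : Set V} {g f h : V → ℂ} (hf : IntegralOver X g f)
    (hh : IntegralOver X g h) : IntegralOver X g (fun x => f x + h x) :=
  integralOver_iff.2 ((integralOver_iff.1 hf).add _ (integralOver_iff.1 hh))

theorem integralOver_poly {V : Type*} {X : Set V} {g : V → ℂ} (p : ℂ[X]) :
    IntegralOver X g (fun x => p.eval (g x)) :=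
  ⟨Polynomial.X - Polynomial.C p, Polynomial.monic_X_sub_C _,
    fun x _ => by simp [Polynomial.evalEval_C]⟩

theorem IntegralOver.mul {V : Type*} {X : Set V} {g f h : V → ℂ} (hf : IntegralOver X g f)
    (hh : IntegralOver X g h) : IntegralOver X g (fun x => f x * h x) :=
  integralOver_iff.2 ((integralOver_iff.1 hf).mul _ (integralOver_iff.1 hh))

/-- If `F(g, f) = 0` on `X` and `a` is not a root of the top form of `F`, then `g` is integral
over `f - a g`. -/
theorem integralOver_sub_mul {V : Type*} {X : Set V} {g f : V → ℂ} {F : MvPolynomial (Fin 2) ℂ}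
    (hF : ∀ x ∈ X, MvPolynomial.eval ![g x, f x] F = 0) {a : ℂ}
    (ha : MvPolynomial.eval ![1, a] (MvPolynomial.homogeneousComponent F.totalDegree F) ≠ 0) :
    IntegralOver X (fun x => f x - a * g x) g := by
  let p : Fin 2 → ℂ[X][Y] :=
    ![Polynomial.X, Polynomial.C Polynomial.X + Polynomial.C (Polynomial.C a) * Polynomial.X]
  have hp : ∀ i, (p i).natDegree ≤ 1 := by
    intro i
    fin_cases i
    · exact Polynomial.natDegree_X_le
    · simp only [p, Fin.mk_one, Matrix.cons_val_one, Matrix.cons_val_zero]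
      compute_degree
  set T := MvPolynomial.homogeneousComponent F.totalDegree F
  set c := MvPolynomial.eval ![1, a] T
  have hcoeff : (MvPolynomial.aeval p F).coeff F.totalDegree = Polynomial.C c := by
    rw [MvPolynomial.coeff_aeval_totalDegree F hp]
    have : (MvPolynomial.aeval (R := ℂ) fun i => (p i).coeff 1).toRingHom =
        (Polynomial.C : ℂ →+* ℂ[X]).comp (MvPolynomial.eval ![1, a]) := by
      ext i
      · simp
      · fin_cases i <;> simp [p, Polynomial.coeff_X]
    exact congrArg (fun φ => φ T) this
  have hz : ∀ x ∈ X, (MvPolynomial.aeval p F : ℂ[X][Y]).evalEval (f x - a * g x) (g x) = 0 := by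
    intro x hx
    rw [← hF x hx]
    have : (Polynomial.evalEvalRingHom (f x - a * g x) (g x)).comp
        (MvPolynomial.aeval (R := ℂ) p).toRingHom = MvPolynomial.eval ![g x, f x] := by
      ext i
      · simp
      · fin_cases i <;> simp [p]
    exact congrArg (fun φ => φ F) this
  refine ⟨Polynomial.C (Polynomial.C c⁻¹) * MvPolynomial.aeval p F, ?_, fun x hx => ?_⟩
  · refine Polynomial.monic_of_natDegree_le_of_coeff_eq_one F.totalDegree ?_ ?_
    · exact (Polynomial.natDegree_C_mul_le _ _).trans (MvPolynomial.natDegree_aeval_le F hp)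
    · rw [Polynomial.coeff_C_mul, hcoeff, ← Polynomial.C_mul, inv_mul_cancel₀ ha, Polynomial.C_1]
  · rw [Polynomial.evalEval_mul, hz x hx, mul_zero]

/-- If `F(g, f) = 0` on `X` and `a` is not a root of the top form of `F`, then the growth of `g`
is controlled by that of `f - a g`. -/
theorem exists_norm_le_of_sub_mul {V : Type*} {X : Set V} {g f : V → ℂ}
    {F : MvPolynomial (Fin 2) ℂ} (hF : ∀ x ∈ X, MvPolynomial.eval ![g x, f x] F = 0) {a : ℂ}
    (ha : MvPolynomial.eval ![1, a] (MvPolynomial.homogeneousComponent F.totalDegree F) ≠ 0) :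
    ∃ C, ∀ x ∈ X, ‖g x‖ ≤ C * (1 + ‖f x - a * g x‖) := by
  by_contra! h
  choose x hxX hx using fun k : ℕ => h k
  have hpos : ∀ k, 0 < 1 + ‖f (x k) - a * g (x k)‖ := fun k => by positivity
  have hg : Tendsto (fun k => ‖g (x k)‖) atTop atTop := by
    refine tendsto_atTop_mono (fun k => ?_) tendsto_natCast_atTop_atTop
    refine le_trans ?_ (hx k).le
    exact le_mul_of_one_le_right (Nat.cast_nonneg k)
      (by linarith [norm_nonneg (f (x k) - a * g (x k))])
  have hg0 : ∀ᶠ k in atTop, g (x k) ≠ 0 := by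
    filter_upwards [hg.eventually_gt_atTop 0] with k hk
    exact norm_pos_iff.1 hk
  have hlim : Tendsto (fun k => (g (x k))⁻¹ * (f (x k) - a * g (x k))) atTop (𝓝 0) := by
    rw [tendsto_zero_iff_norm_tendsto_zero]
    refine squeeze_zero' (Eventually.of_forall fun k => norm_nonneg _) ?_
      tendsto_inv_atTop_nhds_zero_nat
    filter_upwards [hg0, eventually_gt_atTop 0] with k hk hk0
    have hk0' : (0 : ℝ) < k := Nat.cast_pos.2 hk0
    rw [norm_mul, norm_inv, inv_mul_le_iff₀ (norm_pos_iff.2 hk), ← div_eq_mul_inv,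
      le_div_iff₀ hk0']
    nlinarith [hx k]
  refine ha (tendsto_nhds_unique (MvPolynomial.tendsto_eval_div_pow_totalDegree F (l := atTop)
    (p := fun k => ![g (x k), f (x k)]) hg ?_) ?_)
  · intro i
    fin_cases i
    · refine tendsto_const_nhds.congr' ?_
      filter_upwards [hg0] with k hk
      simp [inv_mul_cancel₀ hk]
    · have := hlim.add_const a
      rw [zero_add] at this
      refine this.congr' ?_
      filter_upwards [hg0] with k hk
      simp
      field_simp
      ring
  · simp only [hF _ (hxX _), mul_zero]
    exact tendsto_const_nhds

end Projection

section Projection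

variable {n : ℕ}

theorem IsComplexAlgebraicCurve.exists_projection_finset {X : Set (EuclideanSpace ℂ (Fin n))}
    (hX : IsComplexAlgebraicCurve X) (s : Finset (Fin n)) :
    ∃ a : EuclideanSpace ℂ (Fin n) →ₗ[ℂ] ℂ, ∀ i ∈ s, IntegralOver X a (fun x => x i) ∧
      ∃ C, ∀ x ∈ X, ‖x i‖ ≤ C * (1 + ‖a x‖) := by
  classical
  induction s using Finset.induction_on with
  | empty => exact ⟨0, by simp⟩
  | insert i s _ ih =>
    obtain ⟨a, ha⟩ := ih
    let b : EuclideanSpace ℂ (Fin n) →ₗ[ℂ] ℂ := EuclideanSpace.projₗ i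
    obtain ⟨F, hF, hFX⟩ := hX.exists_linear_dependence a b
    obtain ⟨t, ht⟩ := ((MvPolynomial.homogeneousComponent_isHomogeneous _ F).finite_zeros
      (MvPolynomial.homogeneousComponent_totalDegree_ne_zero hF)).infinite_compl.nonempty
    have hintegral := integralOver_sub_mul hFX ht
    obtain ⟨C, hC⟩ := exists_norm_le_of_sub_mul hFX ht
    refine ⟨b - t • a, fun j hj => ?_⟩
    rcases Finset.mem_insert.1 hj with rfl | hj
    · constructor
      · have h1 := (integralOver_poly (X := X) (g := fun x => b x - t * a x) Polynomial.X).add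
          ((integralOver_poly (Polynomial.C t)).mul hintegral)
        have e : (fun x : EuclideanSpace ℂ (Fin n) => x j) = fun x =>
            (Polynomial.X : Polynomial ℂ).eval (b x - t * a x) +
              (Polynomial.C t).eval (b x - t * a x) * a x := by
          ext x
          simp [b]
        rw [e]
        exact h1
      · refine ⟨1 + ‖t‖ * C, fun x hx => ?_⟩
        have e : x j = (b x - t * a x) + t * a x := by simp [b]
        have h1 := hC x hx
        have h2 := norm_add_le (b x - t * a x) (t * a x)
        rw [← e, norm_mul] at h2
        have h3 := mul_le_mul_of_nonneg_left h1 (norm_nonneg t)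
        simp only [LinearMap.sub_apply, LinearMap.smul_apply, smul_eq_mul]
        nlinarith [norm_nonneg t]
    · obtain ⟨h1, C', hC'⟩ := ha j hj
      refine ⟨hintegral.trans h1, |C'| * (1 + |C|), fun x hx => ?_⟩
      have h2 := hC x hx
      have h3 := hC' x hx
      simp only [LinearMap.sub_apply, LinearMap.smul_apply, smul_eq_mul]
      set r := ‖b x - t * a x‖
      have hr : 0 ≤ r := norm_nonneg _
      calc ‖x j‖ ≤ C' * (1 + ‖a x‖) := h3
        _ ≤ |C'| * (1 + ‖a x‖) := by gcongr; exact le_abs_self _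
        _ ≤ |C'| * (1 + |C| * (1 + r)) := by
          gcongr
          exact h2.trans (by gcongr; exact le_abs_self _)
        _ ≤ |C'| * (1 + |C|) * (1 + r) := by
          rw [mul_assoc]
          gcongr
          nlinarith [abs_nonneg C]

/-- Noether normalization of an algebraic curve by a linear form, with growth control and a finite
set containing the asymptotic directions. -/
theorem IsComplexAlgebraicCurve.exists_projection {X : Set (EuclideanSpace ℂ (Fin n))}
    (hX : IsComplexAlgebraicCurve X) :
    ∃ a : EuclideanSpace ℂ (Fin n) →ₗ[ℂ] ℂ, (∀ i, IntegralOver X a (fun x => x i)) ∧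
      (∃ C, ∀ x ∈ X, ‖x‖ ≤ C * (1 + ‖a x‖)) ∧
      ∃ D : Set (EuclideanSpace ℂ (Fin n)), D.Finite ∧
        ∀ u ∈ tangConeInf X, ‖u‖ = 1 → a u ≠ 0 ∧ (a u)⁻¹ • u ∈ D := by
  obtain ⟨a, ha⟩ := hX.exists_projection_finset Finset.univ
  choose hintegral C hC using fun i => ha i (Finset.mem_univ i)
  have hgrow : ∀ x ∈ X, ‖x‖ ≤ (∑ i, C i) * (1 + ‖a x‖) := by
    intro x hx
    calc ‖x‖ = ‖∑ i, x i • EuclideanSpace.basisFun (Fin n) ℂ i‖ := by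
          conv_lhs => rw [← (EuclideanSpace.basisFun (Fin n) ℂ).sum_repr x]
          simp
      _ ≤ ∑ i, ‖x i‖ := (norm_sum_le _ _).trans_eq (by simp [norm_smul])
      _ ≤ ∑ i, C i * (1 + ‖a x‖) := Finset.sum_le_sum fun i _ => hC i x hx
      _ = _ := by rw [Finset.sum_mul]
  choose F hF hFX using fun i => hX.exists_linear_dependence a (EuclideanSpace.projₗ i)
  let T := fun i => MvPolynomial.homogeneousComponent (F i).totalDegree (F i)
  have hT : ∀ i, (T i).IsHomogeneous (F i).totalDegree := fun i =>
    MvPolynomial.homogeneousComponent_isHomogeneous _ _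
  refine ⟨a, hintegral, ⟨_, hgrow⟩, {v | ∀ i, MvPolynomial.eval ![1, v i] (T i) = 0}, ?_, ?_⟩
  · have hfin : (Set.pi univ fun i => {w : ℂ | MvPolynomial.eval ![1, w] (T i) = 0}).Finite :=
      Set.Finite.pi fun i => (hT i).finite_zeros
        (MvPolynomial.homogeneousComponent_totalDegree_ne_zero (hF i))
    refine (hfin.image (WithLp.toLp 2)).subset fun v hv => ⟨fun i => v i, fun i _ => hv i, rfl⟩
  · rintro u ⟨x, t, hxX, ht, hx, hu⟩ hu1
    have hcont : Continuous a := a.continuous_of_finiteDimensional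
    have hnorm : Tendsto (fun k => (t k)⁻¹ * ‖x k‖) atTop (𝓝 1) := by
      have := hu.norm
      simp only [norm_smul, norm_inv, Real.norm_eq_abs, abs_of_pos (ht _), hu1] at this
      exact this
    have httop : Tendsto t atTop atTop := by
      have h2 : ∀ᶠ k in atTop, (t k)⁻¹ * ‖x k‖ < 2 := hnorm.eventually_lt_const (by norm_num)
      refine tendsto_atTop_mono' _ ?_ (hx.atTop_div_const (by norm_num : (0 : ℝ) < 2))
      filter_upwards [h2] with k hk
      rw [inv_mul_lt_iff₀ (ht k)] at hk
      linarith
    have hau : Tendsto (fun k => ‖a ((t k)⁻¹ • x k)‖) atTop (𝓝 ‖a u‖) :=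
      ((hcont.tendsto u).comp hu).norm
    have hsmul : ∀ (r : ℝ) (v : EuclideanSpace ℂ (Fin n)), a (r • v) = (r : ℂ) * a v := by
      intro r v
      rw [← Complex.coe_smul, map_smul, smul_eq_mul]
    have hle : 1 ≤ (∑ i, C i) * ‖a u‖ := by
      have hlim : Tendsto (fun k => (∑ i, C i) * ((t k)⁻¹ + ‖a ((t k)⁻¹ • x k)‖)) atTop
          (𝓝 ((∑ i, C i) * (0 + ‖a u‖))) :=
        ((tendsto_inv_atTop_zero.comp httop).add hau).const_mul _
      rw [zero_add] at hlim
      refine le_of_tendsto_of_tendsto' hnorm hlim fun k => ?_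
      have h1 := mul_le_mul_of_nonneg_left (hgrow _ (hxX k)) (inv_pos.2 (ht k)).le
      rw [hsmul, norm_mul, Complex.norm_real, norm_inv, Real.norm_eq_abs, abs_of_pos (ht k)]
      calc _ ≤ _ := h1
        _ = _ := by ring
    have ha0 : a u ≠ 0 := by
      intro h
      rw [h, norm_zero, mul_zero] at hle
      linarith
    refine ⟨ha0, fun i => ?_⟩
    have hTu : MvPolynomial.eval ![a u, u i] (T i) = 0 := by
      refine tendsto_nhds_unique (MvPolynomial.tendsto_eval_div_pow_totalDegree (F i) (l := atTop)
        (p := fun k => ![a (x k), x k i]) (t := fun k => (t k : ℂ)) ?_ ?_) ?_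
      · simpa only [Complex.norm_real, Real.norm_eq_abs, abs_of_pos (ht _)] using httop
      · intro j
        fin_cases j
        · refine ((hcont.tendsto u).comp hu).congr fun k => ?_
          simp [hsmul]
        · refine (((EuclideanSpace.proj (𝕜 := ℂ) i).continuous.tendsto u).comp hu).congr fun k => ?_
          simp
      · have : ∀ k, MvPolynomial.eval ![a (x k), x k i] (F i) = 0 := fun k => hFX i _ (hxX k)
        simp only [this, mul_zero]
        exact tendsto_const_nhds
    have e : ![1, ((a u)⁻¹ • u) i] = fun j => (a u)⁻¹ * (![a u, u i] : Fin 2 → ℂ) j := by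
      ext j
      fin_cases j <;> simp [ha0]
    rw [e, (hT i).eval_mul_const, hTu, mul_zero]

end Projection

section PlaneModel

open scoped Polynomial Polynomial.Bivariate

variable {n : ℕ}

theorem integralOver_linearMap {X : Set (EuclideanSpace ℂ (Fin n))}
    {g : EuclideanSpace ℂ (Fin n) → ℂ} (hintegral : ∀ i, IntegralOver X g (fun x => x i))
    (b : EuclideanSpace ℂ (Fin n) →ₗ[ℂ] ℂ) : IntegralOver X g b := by
  have h : ∀ s : Finset (Fin n), IntegralOver X g
      (fun x => ∑ i ∈ s, x i * b (EuclideanSpace.single i 1)) := by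
    intro s
    induction s using Finset.induction_on with
    | empty => simpa using integralOver_poly (X := X) (g := g) 0
    | insert i s hi ih =>
      simp only [Finset.sum_insert hi]
      refine ((hintegral i).mul ?_).add ih
      simpa using integralOver_poly (X := X) (g := g)
        (Polynomial.C (b (EuclideanSpace.single i 1)))
  convert h Finset.univ using 2 with x
  rw [← eval_linearFormPoly]
  simp [linearFormPoly, mul_comm]

/-- The fibres of a finite projection are finite of bounded cardinality. -/
theorem exists_fibre_bound {X : Set (EuclideanSpace ℂ (Fin n))}
    {g : EuclideanSpace ℂ (Fin n) → ℂ} (hintegral : ∀ i, IntegralOver X g (fun x => x i)) :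
    ∃ N, ∀ t, {x ∈ X | g x = t}.Finite ∧ {x ∈ X | g x = t}.ncard ≤ N := by
  classical
  choose F hF hFX using hintegral
  let S : ℂ → Finset (Fin n → ℂ) := fun t =>
    Fintype.piFinset fun i => ((F i).map (Polynomial.evalRingHom t)).roots.toFinset
  refine ⟨∏ i, (F i).natDegree, fun t => ?_⟩
  have hmaps : ∀ x ∈ {x ∈ X | g x = t}, x.ofLp ∈ (S t : Set (Fin n → ℂ)) := by
    rintro x ⟨hx, rfl⟩
    simp only [S, Finset.mem_coe, Fintype.mem_piFinset, Multiset.mem_toFinset]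
    intro i
    rw [Polynomial.mem_roots ((hF i).map _).ne_zero, Polynomial.IsRoot,
      ← evalEval_eq_eval_map]
    exact hFX i x hx
  have hinj : Set.InjOn (fun x : EuclideanSpace ℂ (Fin n) => x.ofLp) {x ∈ X | g x = t} :=
    fun x _ y _ h => WithLp.ofLp_injective 2 h
  refine ⟨Set.Finite.of_injOn hmaps hinj (Finset.finite_toSet _), ?_⟩
  refine (Set.ncard_le_ncard_of_injOn _ hmaps hinj (Finset.finite_toSet _)).trans ?_
  rw [Set.ncard_coe_finset, Fintype.card_piFinset]
  refine Finset.prod_le_prod' fun i _ => (Multiset.toFinset_card_le _).trans ?_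
  exact (Polynomial.card_roots' _).trans Polynomial.natDegree_map_le

theorem Set.Finite.exists_linearMap_injOn {S : Set (EuclideanSpace ℂ (Fin n))} (hS : S.Finite) :
    ∃ b : EuclideanSpace ℂ (Fin n) →ₗ[ℂ] ℂ, Set.InjOn b S := by
  have := hS.to_subtype
  obtain ⟨b, hb⟩ := Module.exists_dual_forall_apply_ne_zero (K := ℂ)
    (fun p : {p : S × S // p.1 ≠ p.2} => (p.1.1 : EuclideanSpace ℂ (Fin n)) - p.1.2)
    (fun p => sub_ne_zero.2 fun h => p.2 (Subtype.ext h))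
  refine ⟨b, fun x hx y hy h => ?_⟩
  by_contra hxy
  refine hb ⟨(⟨x, hx⟩, ⟨y, hy⟩), fun h => hxy (congrArg Subtype.val h)⟩ ?_
  rw [map_sub, h, sub_self]

/-- The minimal equation relating two functions on `X`, the second of which is integral over the
first. -/
theorem IntegralOver.exists_minimal_equation {V : Type*} {X : Set V} {g f : V → ℂ}
    (hf : IntegralOver X g f)
    (hpur : ∀ (c : ℂ[X]) (F : ℂ[X][Y]), c ≠ 0 →
      (∀ x ∈ X, c.eval (g x) * F.evalEval (g x) (f x) = 0) →
      ∀ x ∈ X, F.evalEval (g x) (f x) = 0) :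
    ∃ P : ℂ[X][Y], P.Monic ∧ (∀ x ∈ X, P.evalEval (g x) (f x) = 0) ∧
      (∀ F : ℂ[X][Y], (∀ x ∈ X, F.evalEval (g x) (f x) = 0) → P ∣ F) ∧
      ∃ (u v : ℂ[X][Y]) (c : ℂ[X]), c ≠ 0 ∧ u * P + v * P.derivative = Polynomial.C c := by
  classical
  let K := FractionRing ℂ[X]
  let φ := algebraMap ℂ[X] K
  have hφ : Function.Injective φ := IsFractionRing.injective _ _
  obtain ⟨P, ⟨hP, hPX⟩, hmin⟩ := WellFounded.has_min
    (measure (Polynomial.natDegree : ℂ[X][Y] → ℕ)).wf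
    {P : ℂ[X][Y] | P.Monic ∧ ∀ x ∈ X, P.evalEval (g x) (f x) = 0} hf
  have hPm : P.map φ ≠ 0 := (hP.map φ).ne_zero
  have hlift : ∀ Q : K[X], Q ∣ P.map φ → ∃ q : ℂ[X][Y], q.Monic ∧
      q.map φ * Polynomial.C Q.leadingCoeff = Q ∧ Q.leadingCoeff ≠ 0 := by
    intro Q hQ
    have hQ0 : Q.leadingCoeff ≠ 0 :=
      Polynomial.leadingCoeff_ne_zero.2 (ne_zero_of_dvd_ne_zero hPm hQ)
    obtain ⟨q, hq⟩ := IsIntegrallyClosed.eq_map_mul_C_of_dvd K hP hQ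
    refine ⟨q, ?_, hq, hQ0⟩
    have h1 := congrArg Polynomial.leadingCoeff hq
    rw [Polynomial.leadingCoeff_mul, Polynomial.leadingCoeff_C] at h1
    have h2 : (q.map φ).leadingCoeff = 1 := mul_right_cancel₀ hQ0 (by rw [one_mul]; exact h1)
    rw [Polynomial.leadingCoeff_map_of_injective hφ] at h2
    exact hφ (h2.trans (map_one φ).symm)
  have hdvd : ∀ {q : ℂ[X][Y]} {Q F}, q.Monic → Q.leadingCoeff ≠ 0 →
      q.map φ * Polynomial.C Q.leadingCoeff = Q → Q ∣ F.map φ → q ∣ F := by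
    intro q Q F hq _ h hQ
    exact (Polynomial.map_dvd_map φ hφ hq).1 ((Dvd.intro _ h).trans hQ)
  refine ⟨P, hP, hPX, fun F hF => ?_, ?_⟩
  · let G := EuclideanDomain.gcd (P.map φ) (F.map φ)
    obtain ⟨q, hq, hqG, hG0⟩ := hlift G (EuclideanDomain.gcd_dvd_left _ _)
    obtain ⟨p', hp'⟩ := hdvd hq hG0 hqG (EuclideanDomain.gcd_dvd_left _ _)
    obtain ⟨f', hf'⟩ := hdvd hq hG0 hqG (EuclideanDomain.gcd_dvd_right _ _)
    have hcop : IsCoprime (p'.map φ) (f'.map φ) := by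
      have h1 : G = _ := EuclideanDomain.gcd_eq_gcd_ab (P.map φ) (F.map φ)
      set A := EuclideanDomain.gcdA (P.map φ) (F.map φ)
      set B := EuclideanDomain.gcdB (P.map φ) (F.map φ)
      have h2 : Polynomial.C G.leadingCoeff = p'.map φ * A + f'.map φ * B := by
        refine mul_left_cancel₀ (hq.map φ).ne_zero ?_
        rw [hqG, h1, hp', hf', Polynomial.map_mul, Polynomial.map_mul]
        ring
      have h3 : Polynomial.C (G.leadingCoeff)⁻¹ * Polynomial.C G.leadingCoeff = 1 := by
        rw [← Polynomial.C_mul, inv_mul_cancel₀ hG0, Polynomial.C_1]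
      refine ⟨Polynomial.C (G.leadingCoeff)⁻¹ * A, Polynomial.C (G.leadingCoeff)⁻¹ * B, ?_⟩
      rw [← h3, h2]
      ring
    obtain ⟨u, v, c, hc, huv⟩ := exists_mul_add_mul_eq_C hcop
    have hqX : ∀ x ∈ X, q.evalEval (g x) (f x) = 0 := by
      refine hpur c q hc fun x hx => ?_
      have h1 : Polynomial.C c * q = u * P + v * F := by
        rw [← huv, hp', hf']
        ring
      have h2 := congrArg (Polynomial.evalEval (g x) (f x)) h1
      simpa [Polynomial.evalEval_C, hPX x hx, hF x hx] using h2
    have hle : P.natDegree ≤ q.natDegree := not_lt.1 (hmin q ⟨hq, hqX⟩)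
    have hqP : q ∣ P := ⟨p', hp'⟩
    rw [← Polynomial.eq_of_monic_of_dvd_of_natDegree_le hq hP hqP hle] at hf'
    exact ⟨f', hf'⟩
  · have hsq : Squarefree (P.map φ) := by
      intro Q hQ
      obtain ⟨q, hq, hqQ, hQ0⟩ := hlift Q ((Dvd.intro _ rfl).trans hQ)
      have hqq : (q * q).map φ ∣ P.map φ := by
        rw [Polynomial.map_mul]
        exact (mul_dvd_mul (Dvd.intro _ hqQ) (Dvd.intro _ hqQ)).trans hQ
      obtain ⟨r, hr⟩ := (Polynomial.map_dvd_map φ hφ (hq.mul hq)).1 hqq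
      have hrm : r.Monic := (hq.mul hq).of_mul_monic_left (hr ▸ hP)
      have hle : P.natDegree ≤ (q * r).natDegree := by
        refine not_lt.1 (hmin (q * r) ⟨hq.mul hrm, fun x hx => ?_⟩)
        have h1 := hPX x hx
        rw [hr] at h1
        simpa using h1
      rw [hr, (hq.mul hq).natDegree_mul hrm, hq.natDegree_mul hq, hq.natDegree_mul hrm] at hle
      have hq0 : q.natDegree = 0 := by omega
      rw [hq.natDegree_eq_zero.1 hq0, Polynomial.map_one, one_mul] at hqQ
      rw [← hqQ]
      exact Polynomial.isUnit_C.2 hQ0.isUnit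
    have hsep := PerfectField.separable_iff_squarefree.2 hsq
    rw [Polynomial.separable_def, Polynomial.derivative_map] at hsep
    exact exists_mul_add_mul_eq_C hsep

/-- Points of the plane satisfying all the algebraic relations between two linear forms on `X`
lift to `X`, provided that `X` is finite over the plane. -/
theorem IsComplexAlgebraic.exists_lift {X : Set (EuclideanSpace ℂ (Fin n))}
    (hX : IsComplexAlgebraic X) (a b : EuclideanSpace ℂ (Fin n) →ₗ[ℂ] ℂ)
    (hintegral : ∀ i, IntegralOver X a (fun x => x i)) (t w : ℂ)
    (hrel : ∀ F : ℂ[X][Y], (∀ x ∈ X, F.evalEval (a x) (b x) = 0) → F.evalEval t w = 0) :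
    ∃ x ∈ X, a x = t ∧ b x = w := by
  let ψ : ℂ[X][Y] →+* (X → ℂ) := RingHom.pi fun x => Polynomial.evalEvalRingHom (a x) (b x)
  let _ : Algebra ℂ[X][Y] (X → ℂ) := ψ.toAlgebra
  let B := integralClosure ℂ[X][Y] (X → ℂ)
  let m : Ideal ℂ[X][Y] := RingHom.ker (Polynomial.evalEvalRingHom t w)
  have : m.IsPrime := RingHom.ker_isPrime _
  obtain ⟨Q, -, hQ, hQm⟩ := Ideal.exists_ideal_over_prime_of_isIntegral (S := B) m ⊥ (by
    intro F hF
    refine hrel F fun x hx => ?_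
    have h1 : algebraMap ℂ[X][Y] B F = 0 := hF
    exact congrFun (congrArg Subtype.val h1) ⟨x, hx⟩)
  have hcoord : ∀ i, (fun x : X => x.1 i) ∈ B := by
    intro i
    obtain ⟨F, hF, hFX⟩ := hintegral i
    refine ⟨F.map Polynomial.C, hF.map _, ?_⟩
    rw [Polynomial.eval₂_map]
    have h1 : (algebraMap ℂ[X][Y] (X → ℂ)).comp Polynomial.C = compHom X a := by
      ext <;> simp [RingHom.algebraMap_toAlgebra, ψ]
    rw [h1]
    ext x
    rw [eval₂_compHom X a (fun x : X => x.1 i)]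
    exact hFX x x.2
  let θ : MvPolynomial (Fin n) ℂ →+* B := MvPolynomial.eval₂Hom
    ((algebraMap ℂ[X][Y] B).comp (Polynomial.C.comp Polynomial.C)) fun i => ⟨_, hcoord i⟩
  have hθ : ∀ (F : MvPolynomial (Fin n) ℂ) (x : X),
      (θ F).1 x = MvPolynomial.eval (fun j => x.1 j) F := by
    intro F x
    have h1 : ((Pi.evalRingHom (fun _ : X => ℂ) x).comp B.toSubring.subtype).comp θ =
        MvPolynomial.eval (fun j => x.1 j) := by
      ext i
      · have e : (θ (MvPolynomial.C i)).1 = ψ (Polynomial.C (Polynomial.C i)) := by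
          simp only [θ, MvPolynomial.coe_eval₂Hom, MvPolynomial.eval₂_C]
          rfl
        refine (congrFun e x).trans ?_
        simp [ψ]
      · have e : (θ (MvPolynomial.X i)).1 = fun x : X => x.1 i := by
          simp only [θ, MvPolynomial.coe_eval₂Hom, MvPolynomial.eval₂_X]
        refine (congrFun e x).trans ?_
        simp
    exact congrArg (fun φ => φ F) h1
  have := hQ.comap θ
  obtain ⟨M, hM, hQM⟩ := Ideal.exists_le_maximal (Q.comap θ) this.ne_top
  obtain ⟨z, hz⟩ := MvPolynomial.isMaximal_iff_eq_vanishingIdeal_singleton.1 hM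
  have hmem : ∀ F, θ F ∈ Q → MvPolynomial.eval z F = 0 := by
    intro F hF
    have h1 : F ∈ M := hQM hF
    rw [hz, MvPolynomial.mem_vanishingIdeal_singleton_iff] at h1
    simpa [MvPolynomial.aeval_eq_eval] using h1
  have hform : ∀ (c : EuclideanSpace ℂ (Fin n) →ₗ[ℂ] ℂ) (r : ℂ[X][Y]) (s : ℂ),
      (∀ x, r.evalEval (a x) (b x) = c x) → r.evalEval t w = s → c (WithLp.toLp 2 z) = s := by
    intro c r s hr hs
    have h1 := hmem (linearFormPoly c - MvPolynomial.C s) (by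
      have h2 : θ (linearFormPoly c - MvPolynomial.C s) =
          algebraMap ℂ[X][Y] B (r - Polynomial.C (Polynomial.C s)) := by
        apply Subtype.ext
        ext x
        rw [hθ, map_sub, eval_linearFormPoly, ← hr]
        change _ = (r - Polynomial.C (Polynomial.C s)).evalEval (a x) (b x)
        simp
      rw [h2, ← Ideal.mem_comap, hQm]
      simp [m, RingHom.mem_ker, hs])
    rw [map_sub, MvPolynomial.eval_C, sub_eq_zero] at h1
    rw [← h1, ← eval_linearFormPoly]
  refine ⟨WithLp.toLp 2 z, ?_, hform a (Polynomial.C Polynomial.X) t ?_ ?_,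
    hform b Polynomial.X w ?_ ?_⟩
  · rw [← hX.idealZeros_idealOf, mem_idealZeros]
    intro F hF
    refine hmem F ?_
    have h1 : θ F = 0 := by
      apply Subtype.ext
      ext x
      rw [hθ]
      exact hF x.1 x.2
    rw [h1]
    exact Q.zero_mem
  all_goals simp [Polynomial.evalEval_C]

end PlaneModel

section PlaneProjection

open scoped Polynomial Polynomial.Bivariate

variable {n : ℕ}

theorem IsComplexAlgebraicCurve.isClosed {X : Set (EuclideanSpace ℂ (Fin n))}
    (hX : IsComplexAlgebraicCurve X) : IsClosed X := by
  obtain ⟨m, P, rfl⟩ := hX.1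
  have : {x : EuclideanSpace ℂ (Fin n) | ∀ i, MvPolynomial.eval (fun j => x j) (P i) = 0} =
      ⋂ i, {x | MvPolynomial.eval (fun j => x j) (P i) = 0} := by
    ext x
    simp
  rw [this]
  refine isClosed_iInter fun i => isClosed_eq ?_ continuous_const
  exact (MvPolynomial.continuous_eval (P i)).comp (PiLp.continuous_ofLp 2 _)

theorem IsComplexAlgebraicCurve.evalEval_eq_zero_of_mul {X : Set (EuclideanSpace ℂ (Fin n))}
    (hX : IsComplexAlgebraicCurve X) {a : EuclideanSpace ℂ (Fin n) →ₗ[ℂ] ℂ}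
    (b : EuclideanSpace ℂ (Fin n) →ₗ[ℂ] ℂ) (hfib : ∀ t, {x ∈ X | a x = t}.Finite)
    (c : ℂ[X]) (F : ℂ[X][Y]) (hc : c ≠ 0)
    (h : ∀ x ∈ X, c.eval (a x) * F.evalEval (a x) (b x) = 0) :
    ∀ x ∈ X, F.evalEval (a x) (b x) = 0 := by
  have key : ∀ G : ℂ[X][Y], ∃ G' : MvPolynomial (Fin n) ℂ,
      ∀ x : EuclideanSpace ℂ (Fin n), MvPolynomial.eval (fun j => x j) G' =
        G.evalEval (a x) (b x) := by
    intro G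
    refine ⟨MvPolynomial.bind₁ ![linearFormPoly a, linearFormPoly b] (bivariateToMv G),
      fun x => ?_⟩
    rw [← MvPolynomial.aeval_eq_eval, MvPolynomial.aeval_bind₁, MvPolynomial.aeval_eq_eval]
    rw [eval_bivariateToMv]
    simp [MvPolynomial.aeval_eq_eval, eval_linearFormPoly]
  obtain ⟨c', hc'⟩ := key (Polynomial.C c)
  obtain ⟨F', hF'⟩ := key F
  have h1 := hX.eval_eq_zero_of_mul (f := c') (g := F') ?_ fun x hx => ?_
  · exact fun x hx => by rw [← hF', h1 x hx]
  · refine ((Polynomial.rootSet_finite c ℂ).biUnion fun t _ => hfib t).subset ?_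
    rintro x ⟨hx, hx0⟩
    refine mem_iUnion₂.2 ⟨a x, ?_, hx, rfl⟩
    rw [hc', Polynomial.evalEval_C] at hx0
    simpa [Polynomial.mem_rootSet, hc] using hx0
  · rw [hc', hF', Polynomial.evalEval_C]
    exact h x hx

/-- A monic bivariate polynomial satisfying a Bézout identity with its derivative has as many
zeros over a point as its degree, away from the zeros of the right-hand side. -/
theorem ncard_zeros_of_bezout {P u v : ℂ[X][Y]} {c : ℂ[X]} (hP : P.Monic)
    (h : u * P + v * P.derivative = Polynomial.C c) {t : ℂ} (ht : c.eval t ≠ 0) :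
    {w | P.evalEval t w = 0}.ncard = P.natDegree := by
  classical
  set p := P.map (Polynomial.evalRingHom t) with hp
  have hsep : p.Separable := by
    rw [Polynomial.separable_def]
    have h1 := congrArg (Polynomial.map (Polynomial.evalRingHom t)) h
    rw [Polynomial.map_add, Polynomial.map_mul, Polynomial.map_mul, Polynomial.map_C,
      ← Polynomial.derivative_map] at h1
    have h2 : Polynomial.C (c.eval t)⁻¹ * Polynomial.C (c.eval t) = (1 : ℂ[X]) := by
      rw [← Polynomial.C_mul, inv_mul_cancel₀ ht, Polynomial.C_1]
    refine ⟨Polynomial.C (c.eval t)⁻¹ * u.map (Polynomial.evalRingHom t),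
      Polynomial.C (c.eval t)⁻¹ * v.map (Polynomial.evalRingHom t), ?_⟩
    rw [mul_assoc, mul_assoc, ← mul_add, h1]
    exact h2
  have hset : {w | P.evalEval t w = 0} = (p.roots.toFinset : Set ℂ) := by
    ext w
    simp [evalEval_eq_eval_map, (hP.map (Polynomial.evalRingHom t)).ne_zero, hp]
  rw [hset, Set.ncard_coe_finset, Multiset.toFinset_card_of_nodup (Polynomial.nodup_roots hsep),
    ← (IsAlgClosed.splits p).natDegree_eq_card_roots, hP.natDegree_map]

theorem ncard_zeros_le {P : ℂ[X][Y]} (hP : P.Monic) (t : ℂ) :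
    {w | P.evalEval t w = 0}.Finite ∧ {w | P.evalEval t w = 0}.ncard ≤ P.natDegree := by
  classical
  have hset : {w | P.evalEval t w = 0} =
      ((P.map (Polynomial.evalRingHom t)).roots.toFinset : Set ℂ) := by
    ext w
    simp [evalEval_eq_eval_map, (hP.map (Polynomial.evalRingHom t)).ne_zero]
  rw [hset, Set.ncard_coe_finset]
  exact ⟨Finset.finite_toSet _, (Multiset.toFinset_card_le _).trans
    ((Polynomial.card_roots' _).trans Polynomial.natDegree_map_le)⟩

/-- Every algebraic curve has a linear projection onto a plane algebraic curve which is proper,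
injective near infinity, and injective on asymptotic directions. -/
theorem IsComplexAlgebraicCurve.exists_plane_projection {X : Set (EuclideanSpace ℂ (Fin n))}
    (hX : IsComplexAlgebraicCurve X) :
    ∃ (a b : EuclideanSpace ℂ (Fin n) →ₗ[ℂ] ℂ) (P : ℂ[X][Y]), P.Monic ∧ 0 < P.natDegree ∧
      (fun x => !₂[a x, b x]) '' X = planeZeros P ∧
      (∃ C, ∀ x ∈ X, ‖x‖ ≤ C * (1 + ‖a x‖)) ∧
      (∃ R, ∀ x ∈ X, ∀ y ∈ X, R < ‖a x‖ → a x = a y → b x = b y → x = y) ∧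
      (∀ u ∈ tangConeInf X, ‖u‖ = 1 → a u ≠ 0) ∧
      ∀ u ∈ tangConeInf X, ∀ v ∈ tangConeInf X, ‖u‖ = 1 → ‖v‖ = 1 →
        b u / a u = b v / a v → (a u)⁻¹ • u = (a v)⁻¹ • v := by
  obtain ⟨a, hintegral, hC, D, hD, hDX⟩ := hX.exists_projection
  obtain ⟨N, hN⟩ := exists_fibre_bound hintegral
  obtain ⟨t₀, ht₀⟩ : ∃ t₀, ∀ t, {x ∈ X | a x = t}.ncard ≤ {x ∈ X | a x = t₀}.ncard := by
    have hbdd : BddAbove (range fun t => {x ∈ X | a x = t}.ncard) :=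
      ⟨N, by rintro _ ⟨t, rfl⟩; exact (hN t).2⟩
    obtain ⟨t₀, h⟩ := Nat.sSup_mem (range_nonempty _) hbdd
    exact ⟨t₀, fun t => (le_csSup hbdd ⟨t, rfl⟩).trans_eq h.symm⟩
  obtain ⟨b, hb⟩ := (hD.union (hN t₀).1).exists_linearMap_injOn
  have hbint : IntegralOver X a b := integralOver_linearMap hintegral b
  obtain ⟨P, hP, hPX, hPdvd, u, v, c, hc, huv⟩ := hbint.exists_minimal_equation
    (hX.evalEval_eq_zero_of_mul b fun t => (hN t).1)
  have hlift : ∀ t w, P.evalEval t w = 0 → ∃ x ∈ X, a x = t ∧ b x = w := by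
    refine fun t w h => hX.1.exists_lift a b hintegral t w fun F hF => ?_
    obtain ⟨G, rfl⟩ := hPdvd F hF
    rw [Polynomial.evalEval_mul, h, zero_mul]
  have hfib : ∀ t, b '' {x ∈ X | a x = t} = {w | P.evalEval t w = 0} := by
    intro t
    ext w
    constructor
    · rintro ⟨x, ⟨hx, rfl⟩, rfl⟩
      exact hPX x hx
    · intro hw
      obtain ⟨x, hx, hxt, hxw⟩ := hlift t w hw
      exact ⟨x, ⟨hx, hxt⟩, hxw⟩
  have hinj : ∀ t, c.eval t ≠ 0 → InjOn b {x ∈ X | a x = t} := by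
    intro t ht
    refine Set.injOn_of_ncard_image_eq (le_antisymm (Set.ncard_image_le (hN t).1) ?_) (hN t).1
    calc _ ≤ _ := ht₀ t
      _ = (b '' {x ∈ X | a x = t₀}).ncard :=
        ((hb.mono subset_union_right).ncard_image).symm
      _ ≤ P.natDegree := by
        rw [hfib]
        exact (ncard_zeros_le hP t₀).2
      _ = _ := by rw [hfib, ncard_zeros_of_bezout hP huv ht]
  refine ⟨a, b, P, hP, ?_, ?_, hC, ?_, fun u hu hu1 => (hDX u hu hu1).1, ?_⟩
  · obtain ⟨x, hx⟩ := hX.2.1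
    rw [Nat.pos_iff_ne_zero]
    intro h0
    have h1 := hPX x hx
    rw [hP.natDegree_eq_zero.1 h0, Polynomial.evalEval_one] at h1
    exact one_ne_zero h1
  · ext y
    constructor
    · rintro ⟨x, hx, rfl⟩
      simpa [mem_planeZeros] using hPX x hx
    · intro hy
      obtain ⟨x, hx, hx0, hx1⟩ := hlift (y 0) (y 1) hy
      refine ⟨x, hx, ?_⟩
      ext i
      fin_cases i <;> simp [hx0, hx1]
  · obtain ⟨R, hR⟩ := (Polynomial.rootSet_finite c ℂ).isBounded.exists_norm_le
    refine ⟨R, fun x hx y hy hxR hxy hb' => hinj (a x) ?_ ⟨hx, rfl⟩ ⟨hy, hxy.symm⟩ hb'⟩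
    intro h0
    refine absurd (hR (a x) ?_) (not_le.2 hxR)
    simpa [Polynomial.mem_rootSet, hc] using h0
  · intro u hu v hv hu1 hv1 h
    refine hb (Or.inl (hDX u hu hu1).2) (Or.inl (hDX v hv hv1).2) ?_
    rw [map_smul, map_smul, smul_eq_mul, smul_eq_mul, inv_mul_eq_div, inv_mul_eq_div, h]

end PlaneProjection

/-- every complex algebraic curve is blow-spherical homeomorphic at infinity to a
plane algebraic curve. -/
theorem bs_at_infinity_to_plane_curve {n : ℕ} (X : Set (EuclideanSpace ℂ (Fin n)))
    (hX : IsComplexAlgebraicCurve X) :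
    ∃ Y : Set (EuclideanSpace ℂ (Fin 2)),
      IsComplexAlgebraicCurve Y ∧ BSHomeoAtInfinity X Y := by
  obtain ⟨a, b, P, hP, hd, himage, ⟨C, hC⟩, ⟨R, hR⟩, ha, hD⟩ := hX.exists_plane_projection
  let q : EuclideanSpace ℂ (Fin n) →ₗ[ℂ] EuclideanSpace ℂ (Fin 2) :=
    { toFun := fun x => !₂[a x, b x]
      map_add' := fun x y => by ext i; fin_cases i <;> simp
      map_smul' := fun r x => by ext i; fin_cases i <;> simp }
  let p : EuclideanSpace ℂ (Fin n) →L[ℝ] EuclideanSpace ℂ (Fin 2) :=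
    q.toContinuousLinearMap.restrictScalars ℝ
  have hp0 : ∀ x, p x 0 = a x := fun _ => rfl
  have hp1 : ∀ x, p x 1 = b x := fun _ => rfl
  have hap : ∀ x, ‖a x‖ ≤ ‖p x‖ := fun x => PiLp.norm_apply_le (p x) 0
  have hgrow : ∀ x ∈ X, ‖x‖ ≤ |C| * (1 + ‖a x‖) := fun x hx =>
    (hC x hx).trans (by gcongr; exact le_abs_self C)
  refine ⟨planeZeros P, isComplexAlgebraicCurve_planeZeros hP hd, ?_⟩
  rw [← himage]
  refine bsHomeoAtInfinity_image p hX.isClosed (c := |C|)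
    (R := ‖p‖ * (|C| * (1 + |R|)) + 1) (by positivity) (fun x hx => ?_) ?_ ?_
  · refine (hgrow x hx).trans ?_
    gcongr
    exact hap x
  · rintro x ⟨hx, hxR⟩ y ⟨hy, -⟩ hxy
    have h0 := congrArg (fun z : EuclideanSpace ℂ (Fin 2) => z 0) hxy
    have h1 := congrArg (fun z : EuclideanSpace ℂ (Fin 2) => z 1) hxy
    refine hR x hx y hy ?_ h0 h1
    by_contra! hle
    have h2 : ‖p x‖ ≤ ‖p‖ * (|C| * (1 + |R|)) := by
      refine (p.le_opNorm x).trans ?_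
      gcongr
      refine (hgrow x hx).trans ?_
      gcongr
      exact hle.trans (le_abs_self R)
    have h3 : ‖p‖ * (|C| * (1 + |R|)) + 1 ≤ ‖p x‖ := hxR
    linarith
  · intro u hu v hv hu1 hv1 huv
    have hau := ha u hu hu1
    have hav := ha v hv hv1
    have hpu : 0 < ‖p u‖ := (norm_pos_iff.2 hau).trans_le (hap u)
    have hpv : 0 < ‖p v‖ := (norm_pos_iff.2 hav).trans_le (hap v)
    obtain ⟨s, hs, hsu⟩ : ∃ s : ℝ, 0 < s ∧ p u = s • p v := by
      refine ⟨‖p u‖ * ‖p v‖⁻¹, by positivity, ?_⟩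
      rw [mul_smul, ← huv, smul_smul, mul_inv_cancel₀ hpu.ne', one_smul]
    have ea : a u = s * a v := by
      have := congrArg (fun z : EuclideanSpace ℂ (Fin 2) => z 0) hsu
      simpa [hp0] using this
    have eb : b u = s * b v := by
      have := congrArg (fun z : EuclideanSpace ℂ (Fin 2) => z 1) hsu
      simpa [hp1] using this
    have hs' : (s : ℂ) ≠ 0 := Complex.ofReal_ne_zero.2 hs.ne'
    have hdir := hD u hu v hv hu1 hv1 (by rw [ea, eb, mul_div_mul_left _ _ hs'])
    have huv' : u = (s : ℂ) • v := by
      rw [inv_smul_eq_iff₀ hau, smul_smul, ea, mul_assoc, mul_inv_cancel₀ hav, mul_one] at hdir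
      exact hdir
    have hs1 : s = 1 := by
      have := congrArg norm huv'
      rw [norm_smul, hu1, hv1, mul_one, Complex.norm_real, Real.norm_of_nonneg hs.le] at this
      exact this.symm
    rw [huv', hs1, Complex.ofReal_one, one_smul]

end
end

section
/- Let X = {(x,y) ∈ ℂ² : x·y = 0} and Y = {(x,y) ∈ ℂ² : x·(y − x²) = 0}. Then X and Y are homeomorphic (with their subspace topologies), but their projective closures X̄ ⊆ ℙ²(ℂ) and Ȳ ⊆ ℙ²(ℂ) are not homeomorphic. -/
open Filter Set Topology

noncomputable section

section Algebraic

/-- The quotient topology on the projectivization `ℙ K V`. -/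
instance projectivizationTopology (K V : Type*) [DivisionRing K] [AddCommGroup V] [Module K V]
    [TopologicalSpace V] : TopologicalSpace (Projectivization K V) :=
  inferInstanceAs (TopologicalSpace (Quotient (projectivizationSetoid K V)))

end Algebraic

/-- Continuous maps to `V ∖ {0}` induce continuous maps to the projectivization. -/
theorem Projectivization.continuous_mk {K V X : Type*} [DivisionRing K] [AddCommGroup V]
    [Module K V] [TopologicalSpace V] [TopologicalSpace X] {f : X → V} (hf : Continuous f)
    (h : ∀ x, f x ≠ 0) : Continuous fun x => Projectivization.mk K (f x) (h x) :=
  continuous_quotient_mk'.comp (hf.subtype_mk h)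

theorem Projectivization.rep_mk_zero_iff {K V : Type*} [Field K] [AddCommGroup V] [Module K V]
    {Q : V → K} {d : ℕ} (hQ : ∀ (a : K) v, Q (a • v) = a ^ d * Q v) (v : V) (hv : v ≠ 0) :
    Q (Projectivization.mk K v hv).rep = 0 ↔ Q v = 0 := by
  obtain ⟨a, ha⟩ := Projectivization.exists_smul_eq_mk_rep K v hv
  rw [← ha, Units.smul_def, hQ]
  simp

/-- The zero locus of a continuous homogeneous function is closed. -/
theorem Projectivization.isClosed_zeroLocus {K V : Type*} [Field K] [TopologicalSpace K]
    [T1Space K] [AddCommGroup V] [Module K V] [TopologicalSpace V] {Q : V → K} {d : ℕ}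
    (hc : Continuous Q) (hQ : ∀ (a : K) v, Q (a • v) = a ^ d * Q v) :
    IsClosed {p : Projectivization K V | Q p.rep = 0} := by
  refine (isQuotientMap_quotient_mk' (s := projectivizationSetoid K V)).isClosed_preimage.1 ?_
  convert (isClosed_singleton (x := (0 : K))).preimage (hc.comp continuous_subtype_val) using 1
  ext v
  exact Projectivization.rep_mk_zero_iff hQ v.1 v.2

theorem isConnected_compl_ker_of_surjective {E : Type*} [AddCommGroup E]
    [TopologicalSpace E] [IsTopologicalAddGroup E] [Module ℝ E] [ContinuousSMul ℝ E]
    (L : E →ₗ[ℝ] ℂ) (hL : Function.Surjective L) :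
    IsConnected ((LinearMap.ker L : Set E)ᶜ) := by
  apply isConnected_compl_of_one_lt_codim
  rw [← Cardinal.lift_lt, (L.quotKerEquivOfSurjective hL).lift_rank_eq, Complex.rank_real_complex]
  simp

/-- A continuous map on `ℂ² ∖ {0}` whose fibres are the punctured complex lines through the origin
has connected image, even after removing a point. -/
theorem isPreconnected_range_diff_singleton {α : Type*} [TopologicalSpace α]
    {f : {v : ℂ × ℂ // v ≠ 0} → α} (hc : Continuous f)
    (hf : ∀ v w, f v = f w ↔ v.1.1 * w.1.2 = v.1.2 * w.1.1) (q : α) :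
    IsPreconnected (range f \ {q}) := by
  have h : IsPreconnected (Subtype.val '' (f ⁻¹' {q}ᶜ)) := by
    by_cases hq : q ∈ range f
    · obtain ⟨w, rfl⟩ := hq
      let L : ℂ × ℂ →ₗ[ℝ] ℂ :=
        { toFun := fun v => v.1 * w.1.2 - v.2 * w.1.1
          map_add' := fun x y => by simp; ring
          map_smul' := fun a x => by simp; ring }
      have hL : Function.Surjective L := by
        intro z
        by_cases h1 : w.1.1 = 0
        · have h2 : w.1.2 ≠ 0 := fun h2 => w.2 (Prod.ext h1 h2)
          exact ⟨(z / w.1.2, 0), by simp [L, h2]⟩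
        · exact ⟨(0, -(z / w.1.1)), by simp [L, h1]⟩
      convert (isConnected_compl_ker_of_surjective L hL).isPreconnected using 1
      ext v
      simp only [mem_image, mem_preimage, mem_compl_iff, mem_singleton_iff, hf, Subtype.exists,
        exists_and_right, exists_eq_right, SetLike.mem_coe, LinearMap.mem_ker]
      change _ ↔ ¬ (v.1 * w.1.2 - v.2 * w.1.1 = 0)
      rw [sub_eq_zero]
      refine ⟨fun ⟨_, h⟩ => h, fun h => ⟨?_, h⟩⟩
      rintro rfl
      simp at h
    · have : f ⁻¹' {q}ᶜ = univ := eq_univ_of_forall fun v hv => hq ⟨v, hv⟩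
      rw [this, image_univ, Subtype.range_coe_subtype]
      refine (isConnected_compl_singleton_of_one_lt_rank ?_ (0 : ℂ × ℂ)).isPreconnected
      rw [rank_prod', Complex.rank_real_complex]
      norm_num
  replace h := Topology.IsInducing.subtypeVal.isPreconnected_image.1 h
  convert h.image f hc.continuousOn using 1
  ext p
  simp only [Set.mem_sdiff, mem_range, mem_singleton_iff, mem_image, mem_preimage, mem_compl_iff]
  constructor
  · rintro ⟨⟨v, rfl⟩, h⟩
    exact ⟨v, h, rfl⟩
  · rintro ⟨v, h, rfl⟩
    exact ⟨⟨v, rfl⟩, h⟩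

/-- The parametrization `[s : t] ↦ [s : 0 : t]` of a projective line. -/
def projLine (v : {v : ℂ × ℂ // v ≠ 0}) : Projectivization ℂ (Fin (2 + 1) → ℂ) :=
  Projectivization.mk ℂ ![v.1.1, 0, v.1.2] fun h =>
    v.2 (Prod.ext (by simpa using congrFun h 0) (by simpa using congrFun h 2))

/-- The parametrization `[s : t] ↦ [s² : st : t²]` of a projective conic. -/
def projConic (v : {v : ℂ × ℂ // v ≠ 0}) : Projectivization ℂ (Fin (2 + 1) → ℂ) :=
  Projectivization.mk ℂ ![v.1.1 ^ 2, v.1.1 * v.1.2, v.1.2 ^ 2] fun h =>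
    v.2 (Prod.ext (by simpa using congrFun h 0) (by simpa using congrFun h 2))

theorem vec_three_eq_iff {a b c : ℂ} {v : Fin (2 + 1) → ℂ} :
    v = ![a, b, c] ↔ v 0 = a ∧ v 1 = b ∧ v 2 = c := by
  constructor
  · rintro rfl
    simp
  · rintro ⟨rfl, rfl, rfl⟩
    ext i
    fin_cases i <;> rfl

theorem projIota_eq_mk (z : EuclideanSpace ℂ (Fin 2)) :
    projIota z = Projectivization.mk ℂ ![1, z 0, z 1] fun h => by simpa using congrFun h 0 := by
  simp only [projIota]
  congr 1
  exact vec_three_eq_iff.2 ⟨rfl, rfl, rfl⟩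

theorem continuous_projLine : Continuous projLine :=
  Projectivization.continuous_mk (by fun_prop) _

theorem continuous_projConic : Continuous projConic :=
  Projectivization.continuous_mk (by fun_prop) _

theorem projLine_eq_iff (v w : {v : ℂ × ℂ // v ≠ 0}) :
    projLine v = projLine w ↔ v.1.1 * w.1.2 = v.1.2 * w.1.1 := by
  obtain ⟨⟨s, t⟩, hv⟩ := v
  obtain ⟨⟨s', t'⟩, hw⟩ := w
  simp only [projLine, Projectivization.mk_eq_mk_iff', vec_three_eq_iff]
  simp only [ne_eq, Prod.mk_eq_zero, not_and_or] at hw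
  constructor
  · rintro ⟨a, h0, -, h2⟩
    simp at h0 h2
    rw [← h0, ← h2]; ring
  · intro h
    rcases hw with h0 | h0
    · refine ⟨s / s', ?_, ?_, ?_⟩ <;> simp <;> field_simp
      linear_combination h
    · refine ⟨t / t', ?_, ?_, ?_⟩ <;> simp <;> field_simp
      linear_combination -h

theorem projConic_eq_iff (v w : {v : ℂ × ℂ // v ≠ 0}) :
    projConic v = projConic w ↔ v.1.1 * w.1.2 = v.1.2 * w.1.1 := by
  obtain ⟨⟨s, t⟩, hv⟩ := v
  obtain ⟨⟨s', t'⟩, hw⟩ := w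
  simp only [projConic, Projectivization.mk_eq_mk_iff', vec_three_eq_iff]
  simp only [ne_eq, Prod.mk_eq_zero, not_and_or] at hw
  constructor
  · rintro ⟨a, h0, h1, h2⟩
    simp at h0 h1 h2
    have : (s * t' - t * s') ^ 2 = 0 := by
      linear_combination (-t' ^ 2) * h0 + 2 * s' * t' * h1 - s' ^ 2 * h2
    exact sub_eq_zero.1 (pow_eq_zero_iff two_ne_zero |>.1 this)
  · intro h
    rcases hw with h0 | h0
    · refine ⟨(s / s') ^ 2, ?_, ?_, ?_⟩ <;> simp <;> field_simp
      · linear_combination s * h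
      · linear_combination (s * t' + t * s') * h
    · refine ⟨(t / t') ^ 2, ?_, ?_, ?_⟩ <;> simp <;> field_simp
      · linear_combination -(s * t' + t * s') * h
      · linear_combination -t * h

/-- The projective closure of `x(y - x²) = 0` is the union of a line and a conic. -/
theorem closure_line_union_parabola :
    closure (projIota '' {z : EuclideanSpace ℂ (Fin 2) | z 0 * (z 1 - z 0 ^ 2) = 0}) =
      range projLine ∪ range projConic := by
  apply Subset.antisymm
  · let Q : (Fin (2 + 1) → ℂ) → ℂ := fun v => v 1 * (v 2 * v 0 - v 1 ^ 2)
    have hQ : ∀ (a : ℂ) v, Q (a • v) = a ^ 3 * Q v := fun a v => by simp [Q]; ring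
    refine (closure_minimal ?_
      (Projectivization.isClosed_zeroLocus (d := 3) (by fun_prop : Continuous Q) hQ)).trans ?_
    · rintro _ ⟨z, hz, rfl⟩
      rw [mem_ofPred_eq, projIota_eq_mk, Projectivization.rep_mk_zero_iff hQ]
      simpa [Q] using hz
    · intro p
      induction p using Projectivization.ind with
      | h v hv =>
        rw [mem_ofPred_eq, Projectivization.rep_mk_zero_iff hQ]
        intro h
        have line_mem : v 1 = 0 → Projectivization.mk ℂ v hv ∈ range projLine := by
          intro h1
          have hne : (v 0, v 2) ≠ 0 := fun h0 => hv <| by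
            ext i
            fin_cases i
            exacts [congrArg Prod.fst h0, h1, congrArg Prod.snd h0]
          refine ⟨⟨(v 0, v 2), hne⟩, ?_⟩
          rw [projLine, Projectivization.mk_eq_mk_iff']
          exact ⟨1, by simp [vec_three_eq_iff, h1]⟩
        rcases mul_eq_zero.1 h with h1 | h1
        · exact Or.inl (line_mem h1)
        by_cases h0 : v 0 = 0
        · exact Or.inl (line_mem (by simpa [h0] using h1))
        right
        refine ⟨⟨(v 0, v 1), fun h => h0 (congrArg Prod.fst h)⟩, ?_⟩
        rw [projConic, Projectivization.mk_eq_mk_iff']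
        refine ⟨v 0, vec_three_eq_iff.2 ⟨?_, ?_, ?_⟩⟩ <;> simp
        · ring
        · linear_combination h1
  · have line_mem : ∀ (s t : ℂ) (h : (s, t) ≠ 0), s ≠ 0 → projLine ⟨(s, t), h⟩ ∈
        projIota '' {z : EuclideanSpace ℂ (Fin 2) | z 0 * (z 1 - z 0 ^ 2) = 0} := by
      intro s t h hs
      refine ⟨!₂[0, t / s], by simp, ?_⟩
      rw [projLine, projIota_eq_mk, Projectivization.mk_eq_mk_iff']
      refine ⟨s⁻¹, ?_⟩
      ext i
      fin_cases i <;> simp [hs]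
      field_simp
    have line_sub : range projLine ⊆
        closure (projIota '' {z : EuclideanSpace ℂ (Fin 2) | z 0 * (z 1 - z 0 ^ 2) = 0}) := by
      rintro _ ⟨⟨⟨s, t⟩, hv⟩, rfl⟩
      by_cases hs : s = 0
      · subst hs
        have ht : t ≠ 0 := by simpa using hv
        have hne : ∀ c : ℂ, (c, t) ≠ 0 := fun c h => ht (congrArg Prod.snd h)
        have hcont : Continuous fun c : ℂ => projLine ⟨(c, t), hne c⟩ :=
          continuous_projLine.comp (by fun_prop)
        refine mem_closure_of_tendsto ((hcont.tendsto 0).mono_left nhdsWithin_le_nhds)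
          (b := 𝓝[≠] 0) ?_
        filter_upwards [self_mem_nhdsWithin] with c hc
        exact line_mem c t _ hc
      · exact subset_closure (line_mem s t hv hs)
    refine union_subset line_sub ?_
    rintro _ ⟨⟨⟨s, t⟩, hv⟩, rfl⟩
    by_cases hs : s = 0
    · subst hs
      refine line_sub ⟨⟨(0, t), hv⟩, ?_⟩
      have ht : t ≠ 0 := by simpa using hv
      rw [projLine, projConic, Projectivization.mk_eq_mk_iff']
      refine ⟨t⁻¹, ?_⟩
      rw [vec_three_eq_iff]
      simp [pow_two, ht]
    · refine subset_closure ⟨!₂[t / s, (t / s) ^ 2], by simp, ?_⟩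
      rw [projConic, projIota_eq_mk, Projectivization.mk_eq_mk_iff']
      refine ⟨(s ^ 2)⁻¹, ?_⟩
      ext i
      fin_cases i <;> simp [hs]
      · field_simp
      · field_simp

/-- The projective closure of `x(y - x²) = 0` has no cut points. -/
theorem isPreconnected_closure_line_union_parabola_diff_singleton
    (q : Projectivization ℂ (Fin (2 + 1) → ℂ)) :
    IsPreconnected (closure
      (projIota '' {z : EuclideanSpace ℂ (Fin 2) | z 0 * (z 1 - z 0 ^ 2) = 0}) \ {q}) := by
  rw [closure_line_union_parabola, union_sdiff_distrib]
  have hline := isPreconnected_range_diff_singleton continuous_projLine projLine_eq_iff q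
  have hconic := isPreconnected_range_diff_singleton continuous_projConic projConic_eq_iff q
  let a : {v : ℂ × ℂ // v ≠ 0} := ⟨(1, 0), by simp⟩
  let b : {v : ℂ × ℂ // v ≠ 0} := ⟨(0, 1), by simp⟩
  have ha : projConic a = projLine a := by simp [projConic, projLine, a]
  have hb : projConic b = projLine b := by simp [projConic, projLine, b]
  have hab : projLine a ≠ projLine b := by simp [projLine_eq_iff, a, b]
  by_cases h : projLine a = q
  · have h' : projLine b ≠ q := fun h' => hab (h.trans h'.symm)
    exact hline.union _ ⟨⟨b, rfl⟩, h'⟩ ⟨⟨b, hb⟩, h'⟩ hconic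
  · exact hline.union _ ⟨⟨a, rfl⟩, h⟩ ⟨⟨a, ha⟩, h⟩ hconic

/-- The origin is a cut point of the projective closure of `xy = 0`. -/
theorem not_isPreconnected_closure_axes_diff_origin :
    ¬ IsPreconnected (closure (projIota '' {z : EuclideanSpace ℂ (Fin 2) | z 0 * z 1 = 0}) \
      {projIota 0}) := by
  have hcoord : ∀ (i : Fin (2 + 1)) (a : ℂ) (v : Fin (2 + 1) → ℂ),
      (a • v) i = a ^ 1 * v i := fun i a v => by simp
  have hopen : ∀ i : Fin (2 + 1),
      IsOpen {p : Projectivization ℂ (Fin (2 + 1) → ℂ) | p.rep i ≠ 0} := fun i =>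
    (Projectivization.isClosed_zeroLocus (Q := fun v : Fin (2 + 1) → ℂ => v i)
      (continuous_apply i) (hcoord i)).isOpen_compl
  let Q : (Fin (2 + 1) → ℂ) → ℂ := fun v => v 1 * v 2
  have hQ : ∀ (a : ℂ) v, Q (a • v) = a ^ 2 * Q v := fun a v => by simp [Q]; ring
  have hsub : closure (projIota '' {z : EuclideanSpace ℂ (Fin 2) | z 0 * z 1 = 0}) ⊆
      {p | Q p.rep = 0} := by
    refine closure_minimal ?_
      (Projectivization.isClosed_zeroLocus (d := 2) (by fun_prop : Continuous Q) hQ)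
    rintro _ ⟨z, hz, rfl⟩
    rw [mem_ofPred_eq, projIota_eq_mk, Projectivization.rep_mk_zero_iff hQ]
    simpa [Q] using hz
  have hrep : ∀ (z : EuclideanSpace ℂ (Fin 2)) (i : Fin 2),
      (projIota z).rep i.succ = 0 ↔ z i = 0 := fun z i => by
    rw [projIota]
    exact Projectivization.rep_mk_zero_iff
      (Q := fun v : Fin (2 + 1) → ℂ => v i.succ) (hcoord i.succ) _ _
  have hmem : ∀ z : EuclideanSpace ℂ (Fin 2), z 0 * z 1 = 0 → ∀ i, z i ≠ 0 →
      projIota z ∈ (closure (projIota '' {z : EuclideanSpace ℂ (Fin 2) | z 0 * z 1 = 0}) \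
        {projIota 0}) ∩ {p | p.rep i.succ ≠ 0} := fun z hz i hi =>
    ⟨⟨subset_closure ⟨z, hz, rfl⟩, fun h => hi ((hrep z i).1 (by
      rw [mem_singleton_iff.1 h, hrep]; rfl))⟩, fun h => hi ((hrep z i).1 h)⟩
  intro hpre
  obtain ⟨p, ⟨hp, -⟩, hp1, hp2⟩ := hpre _ _ (hopen 1) (hopen 2) (fun p hp => by
      by_contra! h
      simp only [mem_union, mem_ofPred_eq, not_or, not_not] at h
      refine hp.2 ?_
      rw [mem_singleton_iff, ← p.mk_rep, projIota_eq_mk, Projectivization.mk_eq_mk_iff']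
      refine ⟨p.rep 0, ?_⟩
      ext i
      fin_cases i
      · simp
      · simpa using h.1.symm
      · simpa using h.2.symm)
    ⟨_, hmem !₂[1, 0] (by simp) 0 (by simp)⟩ ⟨_, hmem !₂[0, 1] (by simp) 1 (by simp)⟩
  exact mul_ne_zero hp1 hp2 (hsub hp)

theorem IsHomeoOn.isPreconnected_diff_singleton {α β : Type*} [TopologicalSpace α]
    [TopologicalSpace β] {h : α → β} {X : Set α} {Y : Set β} (hh : IsHomeoOn h X Y) {x : α}
    (hx : x ∈ X) (hY : IsPreconnected (Y \ {h x})) : IsPreconnected (X \ {x}) := by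
  obtain ⟨hbij, -, g, hgh, hhg, hg⟩ := hh
  convert hY.image g (hg.mono sdiff_subset) using 1
  ext z
  constructor
  · rintro ⟨hz, hne⟩
    exact ⟨h z, ⟨hbij.mapsTo hz, fun he => hne (hbij.injOn hz hx he)⟩, hgh z hz⟩
  · rintro ⟨y, ⟨hy, hne⟩, rfl⟩
    obtain ⟨x', hx', rfl⟩ := hbij.surjOn hy
    rw [hgh x' hx']
    exact ⟨hx', fun he => hne (congrArg h he)⟩

/-- the curves `xy = 0` and `x(y - x²) = 0` are homeomorphic, but their
projective closures are not homeomorphic. -/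
theorem homeo_but_projective_closures_not_homeo :
    (∃ h : EuclideanSpace ℂ (Fin 2) → EuclideanSpace ℂ (Fin 2),
      IsHomeoOn h {z : EuclideanSpace ℂ (Fin 2) | z 0 * z 1 = 0}
        {z : EuclideanSpace ℂ (Fin 2) | z 0 * (z 1 - z 0 ^ 2) = 0}) ∧
    ¬ ∃ H : Projectivization ℂ (Fin (2 + 1) → ℂ) → Projectivization ℂ (Fin (2 + 1) → ℂ),
      IsHomeoOn H (closure (projIota '' {z : EuclideanSpace ℂ (Fin 2) | z 0 * z 1 = 0}))
        (closure (projIota '' {z : EuclideanSpace ℂ (Fin 2) | z 0 * (z 1 - z 0 ^ 2) = 0})) := by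
  constructor
  · refine ⟨fun z => !₂[z 0, z 1 + z 0 ^ 2], ?_⟩
    have hinv : ∀ z : EuclideanSpace ℂ (Fin 2), z = !₂[z 0, z 1] := fun z => by
      ext i
      fin_cases i <;> rfl
    have hleft : Function.LeftInverse
        (fun z : EuclideanSpace ℂ (Fin 2) => !₂[z 0, z 1 - z 0 ^ 2])
        (fun z : EuclideanSpace ℂ (Fin 2) => !₂[z 0, z 1 + z 0 ^ 2]) := fun z => by
      conv_rhs => rw [hinv z]
      simp
    have hright : ∀ z : EuclideanSpace ℂ (Fin 2),
        !₂[z 0, (z 1 - z 0 ^ 2) + z 0 ^ 2] = z := fun z => by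
      conv_rhs => rw [hinv z]
      simp
    refine ⟨⟨fun z hz => by simpa using hz, hleft.injective.injOn, fun z hz =>
      ⟨!₂[z 0, z 1 - z 0 ^ 2], by simpa using hz, hright z⟩⟩, by fun_prop,
      fun z => !₂[z 0, z 1 - z 0 ^ 2], fun z _ => hleft z, fun z _ => hright z, by fun_prop⟩
  · rintro ⟨H, hH⟩
    exact not_isPreconnected_closure_axes_diff_origin
      (hH.isPreconnected_diff_singleton (subset_closure ⟨0, by simp, rfl⟩)
        (isPreconnected_closure_line_union_parabola_diff_singleton _))

end
end
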